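/- arXiv:2006.07884 — 3 statements merged into one kernel-verified Lean document; each statement's English description precedes it below -/
import Mathlib

section
/- Fix integers N ≥ 2 and 1 ≤ n ≤ N-1. For α > -1 and β > -1, the Hahn polynomial H_n^{(α,β)} has n distinct real zeros x_1(α,β) < ⋯ < x_n(α,β) in (0, N-1), and for each j ∈ {1,...,n} the zero x_j(α,β) is a strictly decreasing function of α on (-1, ∞) and a strictly increasing function of β on (-1, ∞). -/
/-- Pochhammer symbol `(a)_k = ∏_{j=0}^{k-1} (a + j)`. -/
noncomputable def poch (a : ℝ) (k : ℕ) : ℝ := ∏ j ∈ Finset.range k, (a + (j : ℝ))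

/-- Hahn polynomial `H_n^{(α,β)}(x)`. -/
noncomputable def hahnPoly (N n : ℕ) (α β x : ℝ) : ℝ :=
  ∑ k ∈ Finset.range (n + 1),
    poch (-(n : ℝ)) k * poch (-x) k * poch ((n : ℝ) + α + β + 1) k /
      (poch (β + 1) k * poch (1 - (N : ℝ)) k * (Nat.factorial k : ℝ))

section

open Polynomial Finset

/-- The discrete integral `F ↦ ∑_{i < N} w i * F(i)` as a linear functional on polynomials. -/
noncomputable def weightedSum (N : ℕ) (w : ℕ → ℝ) : ℝ[X] →ₗ[ℝ] ℝ :=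
  ∑ i ∈ range N, w i • leval (i : ℝ)

lemma weightedSum_apply (N : ℕ) (w : ℕ → ℝ) (F : ℝ[X]) :
    weightedSum N w F = ∑ i ∈ range N, w i * F.eval (i : ℝ) := by
  simp [weightedSum]

lemma exists_eval_natCast_ne_zero {N : ℕ} {F : ℝ[X]} (hF : F ≠ 0) (hdeg : F.natDegree < N) :
    ∃ i < N, F.eval (i : ℝ) ≠ 0 := by
  by_contra! h
  refine hF (eq_zero_of_natDegree_lt_card_of_eval_eq_zero F
    (f := fun i : Fin N => ((i : ℕ) : ℝ)) ?_ (fun i => h i i.2) (by simpa using hdeg))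
  intro a b hab
  exact Fin.ext (Nat.cast_injective hab)

lemma weightedSum_pos {N : ℕ} {w : ℕ → ℝ} (hw : ∀ i < N, 0 < w i) {F : ℝ[X]}
    (hF : ∀ i < N, 0 ≤ F.eval (i : ℝ)) (hF' : ∃ i < N, F.eval (i : ℝ) ≠ 0) :
    0 < weightedSum N w F := by
  rw [weightedSum_apply]
  obtain ⟨i, hi, hne⟩ := hF'
  exact sum_pos' (fun k hk => mul_nonneg (hw k (mem_range.1 hk)).le (hF k (mem_range.1 hk)))
    ⟨i, mem_range.2 hi, mul_pos (hw i hi) ((hF i hi).lt_of_ne' hne)⟩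

/-- Multiplying by simple linear factors at interior roots makes a polynomial of constant sign. -/
lemma exists_roots_mul_constant_sign (M : ℝ) (d : ℕ) (p : ℝ[X]) (hp : p ≠ 0)
    (hd : p.natDegree ≤ d) :
    ∃ S : Finset ℝ, (∀ z ∈ S, z ∈ Set.Ioo 0 M ∧ p.eval z = 0) ∧
      ((∀ t ∈ Set.Icc 0 M, 0 ≤ (p * ∏ z ∈ S, (X - C z)).eval t) ∨
        (∀ t ∈ Set.Icc 0 M, (p * ∏ z ∈ S, (X - C z)).eval t ≤ 0)) := by
  induction d generalizing p with
  | zero =>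
    rw [eq_C_of_natDegree_le_zero hd]
    refine ⟨∅, by simp, ?_⟩
    rcases le_total 0 (p.coeff 0) with h | h
    · exact Or.inl (by simp [h])
    · exact Or.inr (by simp [h])
  | succ d ih =>
    by_cases hroot : ∃ z ∈ Set.Ioo 0 M, p.eval z = 0
    · obtain ⟨z, hz, hpz⟩ := hroot
      obtain ⟨q, rfl⟩ := dvd_iff_isRoot.2 hpz
      have hq : q ≠ 0 := right_ne_zero_of_mul hp
      obtain ⟨S, hS, hsign⟩ := ih q hq (by
        rw [natDegree_mul (X_sub_C_ne_zero z) hq, natDegree_X_sub_C] at hd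
        omega)
      by_cases hzS : z ∈ S
      · refine ⟨S.erase z, fun y hy => ⟨(hS y (mem_of_mem_erase hy)).1, ?_⟩, ?_⟩
        · rw [eval_mul, (hS y (mem_of_mem_erase hy)).2, mul_zero]
        · have : (X - C z) * q * ∏ y ∈ S.erase z, (X - C y) = q * ∏ y ∈ S, (X - C y) := by
            rw [← mul_prod_erase S _ hzS]; ring
          rwa [this]
      · refine ⟨insert z S, fun y hy => ?_, ?_⟩
        · rcases mem_insert.1 hy with rfl | hy
          · exact ⟨hz, hpz⟩
          · exact ⟨(hS y hy).1, by rw [eval_mul, (hS y hy).2, mul_zero]⟩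
        · have (t : ℝ) : ((X - C z) * q * ∏ y ∈ insert z S, (X - C y)).eval t =
              (t - z) ^ 2 * (q * ∏ y ∈ S, (X - C y)).eval t := by
            rw [prod_insert hzS]; simp only [eval_mul, eval_sub, eval_X, eval_C]; ring
          simp only [this]
          exact hsign.imp (fun h t ht => mul_nonneg (sq_nonneg _) (h t ht))
            (fun h t ht => mul_nonpos_of_nonneg_of_nonpos (sq_nonneg _) (h t ht))
    · push Not at hroot
      refine ⟨∅, by simp, ?_⟩
      simp only [prod_empty, mul_one]
      by_contra! hcon
      obtain ⟨⟨a, ha, hpa⟩, b, hb, hpb⟩ := hcon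
      obtain ⟨c, hc, hpc⟩ : ∃ c ∈ Set.Ioo 0 M, p.eval c < 0 := by
        have : a ∈ closure (Set.Ioo 0 M) := by
          rcases eq_or_ne 0 M with h | h
          · subst h
            simp only [Set.Icc_self, Set.mem_singleton_iff] at ha hb
            subst ha hb
            exact absurd hpa hpb.not_gt
          · rwa [closure_Ioo h]
        obtain ⟨c, h1, h2⟩ := mem_closure_iff.1 this _
          (isOpen_lt p.continuous continuous_const) hpa
        exact ⟨c, h2, h1⟩
      obtain ⟨e, he, hpe⟩ : ∃ c ∈ Set.Ioo 0 M, 0 < p.eval c := by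
        have : b ∈ closure (Set.Ioo 0 M) := by
          rwa [closure_Ioo (hc.1.trans hc.2).ne]
        obtain ⟨c, h1, h2⟩ := mem_closure_iff.1 this _
          (isOpen_lt continuous_const p.continuous) hpb
        exact ⟨c, h2, h1⟩
      obtain ⟨y, hy, hpy⟩ := isPreconnected_Ioo.intermediate_value hc he p.continuous.continuousOn
        ⟨hpc.le, hpe.le⟩
      exact hroot y hy hpy

/-- A nonzero polynomial of degree at most `n`, orthogonal to all polynomials of smaller degree
with respect to a positive weight on `{0, …, N - 1}`, has `n` distinct zeros in `(0, N - 1)`. -/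
lemma exists_zeros_of_orthogonal {N n : ℕ} (hnN : n < N) {w : ℕ → ℝ} (hw : ∀ i < N, 0 < w i)
    {p : ℝ[X]} (hp : p ≠ 0) (hdeg : p.natDegree ≤ n)
    (horth : ∀ q : ℝ[X], q.degree < n → weightedSum N w (p * q) = 0) :
    ∃ x : Fin n → ℝ, StrictMono x ∧ (∀ j, x j ∈ Set.Ioo (0 : ℝ) ((N : ℝ) - 1)) ∧
      ∃ c : ℝ, p = C c * Lagrange.nodal univ x := by
  obtain ⟨S, hS, hsign⟩ := exists_roots_mul_constant_sign ((N : ℝ) - 1) n p hp hdeg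
  have hSroots : S ⊆ p.roots.toFinset := fun z hz => by simp [hp, (hS z hz).2]
  have hcard : n ≤ #S := by
    by_contra! hlt
    have h0 := horth (∏ z ∈ S, (X - C z)) (by
      rw [degree_prod_of_monic _ _ fun z _ => monic_X_sub_C z]
      simpa using hlt)
    obtain ⟨i, hi, hne⟩ := exists_eval_natCast_ne_zero hp (hdeg.trans_lt hnN)
    have hne' : (p * ∏ z ∈ S, (X - C z)).eval (i : ℝ) ≠ 0 := by
      rw [eval_mul, eval_prod]
      refine mul_ne_zero hne (prod_ne_zero_iff.2 fun z hz => ?_)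
      simp only [eval_sub, eval_X, eval_C, sub_ne_zero]
      rintro rfl
      exact hne (hS _ hz).2
    have hIcc (k : ℕ) (hk : k < N) : (k : ℝ) ∈ Set.Icc (0 : ℝ) ((N : ℝ) - 1) := by
      refine ⟨k.cast_nonneg, ?_⟩
      rw [le_sub_iff_add_le]
      exact_mod_cast hk
    rcases hsign with h | h
    · exact (weightedSum_pos hw (fun k hk => h k (hIcc k hk)) ⟨i, hi, hne'⟩).ne' h0
    · have := weightedSum_pos hw (F := -(p * ∏ z ∈ S, (X - C z)))
        (fun k hk => by simpa using h k (hIcc k hk)) ⟨i, hi, by simpa using hne'⟩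
      rw [map_neg, h0, neg_zero] at this
      exact this.false
  have hcard_roots : #p.roots.toFinset ≤ n :=
    (p.roots.toFinset_card_le.trans p.card_roots').trans hdeg
  have hSeq : #S = n := le_antisymm ((card_le_card hSroots).trans hcard_roots) hcard
  refine ⟨S.orderEmbOfFin hSeq, (S.orderEmbOfFin hSeq).strictMono,
    fun j => (hS _ (S.orderEmbOfFin_mem hSeq j)).1, p.leadingCoeff, ?_⟩
  have hnodal : Lagrange.nodal univ (S.orderEmbOfFin hSeq) = ∏ z ∈ S, (X - C z) := by
    rw [Lagrange.nodal_eq, ← prod_image (f := fun z => X - C z)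
      (S.orderEmbOfFin hSeq).injective.injOn, S.image_orderEmbOfFin_univ hSeq]
  rw [hnodal]
  have hval : S.val ≤ p.roots :=
    (Multiset.le_iff_subset S.nodup).2 fun z hz => Multiset.mem_toFinset.1 (hSroots hz)
  have hroots : S.val = p.roots :=
    Multiset.eq_of_le_of_card_le hval ((p.card_roots'.trans hdeg).trans hcard)
  have := C_leadingCoeff_mul_prod_multiset_X_sub_C (p := p) (le_antisymm p.card_roots' (by
    rw [← hroots]; exact hdeg.trans hcard))
  rw [← hroots] at this
  exact this.symm

/-- Gauss quadrature at the zeros of an orthogonal polynomial. -/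
lemma weightedSum_eq_quadrature {N n : ℕ} {w : ℕ → ℝ} {x : Fin n → ℝ}
    (hx : Function.Injective x)
    (horth : ∀ q : ℝ[X], q.degree < n → weightedSum N w (Lagrange.nodal univ x * q) = 0)
    {F : ℝ[X]} (hF : F.degree < (2 * n : ℕ)) :
    weightedSum N w F =
      ∑ k, F.eval (x k) * weightedSum N w (Lagrange.basis univ x k) := by
  set P := Lagrange.nodal univ x
  have hP : P.Monic := Lagrange.nodal_monic
  have hPdeg : P.degree = n := by simp [P]
  have hmod : (F %ₘ P).degree < #(univ : Finset (Fin n)) := by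
    simpa [hPdeg] using degree_modByMonic_lt F hP
  have hdiv : (F /ₘ P).degree < n := by
    rcases eq_or_ne F 0 with rfl | hF0
    · simp
    rcases eq_or_ne (F /ₘ P) 0 with h0 | h0
    · simp [h0]
    rw [← natDegree_lt_iff_degree_lt h0, natDegree_divByMonic F hP]
    rw [← natDegree_lt_iff_degree_lt hF0] at hF
    have : P.natDegree = n := by simp [P]
    have : n ≠ 0 := by omega
    omega
  have heval (k : Fin n) : (F %ₘ P).eval (x k) = F.eval (x k) := by
    conv_rhs => rw [← modByMonic_add_div F P]
    simp [P, Lagrange.eval_nodal_at_node (mem_univ k)]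
  conv_lhs => rw [← modByMonic_add_div F P, map_add, horth _ hdiv, add_zero,
    Lagrange.eq_interpolate hx.injOn hmod, Lagrange.interpolate_apply, map_sum]
  refine sum_congr rfl fun k _ => ?_
  rw [← smul_eq_C_mul, map_smul, smul_eq_mul, heval]

lemma weightedSum_nonneg_of_eval_nodes_nonneg {N n : ℕ} {w : ℕ → ℝ} (hw : ∀ i < N, 0 < w i)
    {x : Fin n → ℝ} (hx : Function.Injective x)
    (horth : ∀ q : ℝ[X], q.degree < n → weightedSum N w (Lagrange.nodal univ x * q) = 0)
    {F : ℝ[X]} (hF : F.degree < (2 * n : ℕ)) (hnonneg : ∀ k, 0 ≤ F.eval (x k)) :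
    0 ≤ weightedSum N w F := by
  rw [weightedSum_eq_quadrature hx horth hF]
  refine sum_nonneg fun k _ => mul_nonneg (hnonneg k) ?_
  have hdeg : (Lagrange.basis univ x k ^ 2).degree < (2 * n : ℕ) := by
    have hne := Lagrange.basis_ne_zero hx.injOn (mem_univ k)
    rw [← natDegree_lt_iff_degree_lt (pow_ne_zero 2 hne), natDegree_pow,
      Lagrange.natDegree_basis hx.injOn (mem_univ k)]
    have := k.pos
    simp
    omega
  have hsq := weightedSum_eq_quadrature hx horth hdeg
  rw [sum_eq_single k (fun j _ hj => ?_) (by simp)] at hsq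
  · rw [eval_pow, Lagrange.eval_basis_self hx.injOn (mem_univ k), one_pow, one_mul] at hsq
    rw [← hsq, weightedSum_apply]
    refine sum_nonneg fun i hi => mul_nonneg (hw i (mem_range.1 hi)).le ?_
    rw [eval_pow]
    positivity
  · rw [eval_pow, Lagrange.eval_basis_of_ne hj.symm (mem_univ j)]
    simp

/-- A strictly increasing positive sequence admits a positive level crossed exactly at `t`. -/
lemma exists_crossing_level {N : ℕ} {r : ℕ → ℝ} (hr : StrictMonoOn r (Set.Iio N))
    (hpos : ∀ i < N, 0 < r i) {t : ℝ} (ht : t ∈ Set.Ioo (0 : ℝ) ((N : ℝ) - 1)) :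
    ∃ c, 0 < c ∧ ∀ i < N, 0 ≤ ((i : ℝ) - t) * (r i - c) ∧
      ((i : ℝ) ≠ t → 0 < ((i : ℝ) - t) * (r i - c)) := by
  have hfl : (⌊t⌋₊ : ℝ) ≤ t := Nat.floor_le ht.1.le
  have hlt : t < ⌊t⌋₊ + 1 := Nat.lt_floor_add_one t
  have hmN : ⌊t⌋₊ + 1 < N := by
    have : (⌊t⌋₊ : ℝ) + 1 < N := by linarith [ht.2]
    exact_mod_cast this
  set m := ⌊t⌋₊
  have hmono {a b : ℕ} (hab : a < b) (hb : b < N) : r a < r b := hr (hab.trans hb) hb hab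
  have hmono' {a b : ℕ} (hab : a ≤ b) (hb : b < N) : r a ≤ r b :=
    hr.monotoneOn (hab.trans_lt hb) hb hab
  suffices h : ∃ c, 0 < c ∧ ∀ i < N, (i : ℝ) ≠ t → 0 < ((i : ℝ) - t) * (r i - c) by
    obtain ⟨c, hc, h⟩ := h
    refine ⟨c, hc, fun i hi => ⟨?_, h i hi⟩⟩
    rcases eq_or_ne (i : ℝ) t with hit | hit
    · simp [hit]
    · exact (h i hi hit).le
  rcases hfl.eq_or_lt with heq | hmt
  · refine ⟨r m, hpos m (by omega), fun i hi hne => ?_⟩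
    rw [← heq] at hne ⊢
    rcases lt_or_gt_of_ne (Nat.cast_injective.ne_iff.1 hne) with him | him
    · exact mul_pos_of_neg_of_neg (sub_neg.2 (by exact_mod_cast him))
        (sub_neg.2 (hmono him (by omega)))
    · exact mul_pos (sub_pos.2 (by exact_mod_cast him)) (sub_pos.2 (hmono him hi))
  · have h1 := hmono (Nat.lt_succ_self m) hmN
    have h2 := hpos m (by omega)
    refine ⟨(r m + r (m + 1)) / 2, by linarith, fun i hi _ => ?_⟩
    rcases le_or_gt i m with him | him
    · have : (i : ℝ) ≤ m := by exact_mod_cast him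
      have := hmono' him (by omega)
      exact mul_pos_of_neg_of_neg (by linarith) (by linarith)
    · have : (m : ℝ) + 1 ≤ i := by exact_mod_cast him
      have := hmono' him hi
      exact mul_pos (by linarith) (by linarith)

/-- Markov's theorem in comparison form: if the ratio of two positive weights is strictly
increasing, then so are the zeros of the associated orthogonal polynomials. -/
theorem zeros_lt_of_weight_ratio_strictMono {N n : ℕ} (hnN : n < N) {w₁ w₂ r : ℕ → ℝ}
    (hw₁ : ∀ i < N, 0 < w₁ i) (hr : StrictMonoOn r (Set.Iio N)) (hrpos : ∀ i < N, 0 < r i)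
    (hw : ∀ i < N, w₂ i = r i * w₁ i) {x y : Fin n → ℝ} (hx : StrictMono x) (hy : StrictMono y)
    (hxmem : ∀ j, x j ∈ Set.Ioo (0 : ℝ) ((N : ℝ) - 1))
    (horth₁ : ∀ q : ℝ[X], q.degree < n → weightedSum N w₁ (Lagrange.nodal univ x * q) = 0)
    (horth₂ : ∀ q : ℝ[X], q.degree < n → weightedSum N w₂ (Lagrange.nodal univ y * q) = 0)
    (j : Fin n) : x j < y j := by
  have hw₂ : ∀ i < N, 0 < w₂ i := fun i hi => hw i hi ▸ mul_pos (hrpos i hi) (hw₁ i hi)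
  set f : ℝ[X] := ∏ k ∈ univ.erase j, (X - C (if k < j then x k else y k)) with hf
  have hfmonic : f.Monic := monic_prod_of_monic _ _ fun k _ => monic_X_sub_C _
  have hfdeg : f.natDegree = n - 1 := by
    rw [hf, natDegree_prod_of_monic _ _ fun k _ => monic_X_sub_C _]
    simp
  have hfx (k : Fin n) (hk : k < j) : f.eval (x k) = 0 := by
    rw [hf, eval_prod]
    exact prod_eq_zero (mem_erase.2 ⟨hk.ne, mem_univ k⟩) (by simp [hk])
  have hfy (k : Fin n) (hk : j < k) : f.eval (y k) = 0 := by
    rw [hf, eval_prod]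
    exact prod_eq_zero (mem_erase.2 ⟨hk.ne', mem_univ k⟩) (by simp [hk.not_gt])
  have hn : 0 < n := j.pos
  have hlin (t : ℝ) : ((X - C t) * f).Monic ∧ ((X - C t) * f).natDegree = n := by
    refine ⟨(monic_X_sub_C t).mul hfmonic, ?_⟩
    rw [(monic_X_sub_C t).natDegree_mul hfmonic, natDegree_X_sub_C, hfdeg]
    omega
  have hdeg (t : ℝ) : ((X - C t) * f ^ 2).degree < ((2 * n : ℕ) : WithBot ℕ) := by
    have : (X - C t) * f ^ 2 = (X - C t) * f * f := by ring
    rw [← natDegree_lt_iff_degree_lt ((monic_X_sub_C t).mul (hfmonic.pow 2)).ne_zero, this,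
      (hlin t).1.natDegree_mul hfmonic, (hlin t).2, hfdeg]
    omega
  have h₁ : 0 ≤ weightedSum N w₁ ((X - C (x j)) * f ^ 2) := by
    refine weightedSum_nonneg_of_eval_nodes_nonneg hw₁ hx.injective horth₁ (hdeg _) fun k => ?_
    rcases lt_or_ge k j with hk | hk
    · simp [hfx k hk]
    · have := hx.monotone hk
      simp only [eval_mul, eval_sub, eval_X, eval_C, eval_pow]
      exact mul_nonneg (sub_nonneg.2 this) (sq_nonneg _)
  have h₂ : 0 ≤ weightedSum N w₂ (-((X - C (y j)) * f ^ 2)) := by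
    refine weightedSum_nonneg_of_eval_nodes_nonneg hw₂ hy.injective horth₂
      (by rw [degree_neg]; exact hdeg _) fun k => ?_
    rcases lt_or_ge j k with hk | hk
    · simp [hfy k hk]
    · have := hy.monotone hk
      simp only [eval_neg, eval_mul, eval_sub, eval_X, eval_C, eval_pow]
      exact neg_nonneg.2 (mul_nonpos_of_nonpos_of_nonneg (sub_nonpos.2 this) (sq_nonneg _))
  obtain ⟨c, hc, hcross⟩ := exists_crossing_level hr hrpos (hxmem j)
  have h₃ : 0 < weightedSum N w₂ ((X - C (x j)) * f ^ 2) -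
      c * weightedSum N w₁ ((X - C (x j)) * f ^ 2) := by
    have heq : weightedSum N w₂ ((X - C (x j)) * f ^ 2) -
        c * weightedSum N w₁ ((X - C (x j)) * f ^ 2) =
        ∑ i ∈ range N, w₁ i * f.eval (i : ℝ) ^ 2 * (((i : ℝ) - x j) * (r i - c)) := by
      rw [weightedSum_apply, weightedSum_apply, mul_sum, ← sum_sub_distrib]
      refine sum_congr rfl fun i hi => ?_
      rw [hw i (mem_range.1 hi)]
      simp only [eval_mul, eval_sub, eval_X, eval_C, eval_pow]
      ring
    rw [heq]
    obtain ⟨i, hi, hne⟩ := exists_eval_natCast_ne_zero (N := N) (hlin (x j)).1.ne_zero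
      ((hlin (x j)).2.trans_lt hnN)
    simp only [eval_mul, eval_sub, eval_X, eval_C, mul_ne_zero_iff, sub_ne_zero] at hne
    refine sum_pos' (fun k hk => ?_) ⟨i, mem_range.2 hi, ?_⟩
    · exact mul_nonneg (mul_nonneg (hw₁ k (mem_range.1 hk)).le (sq_nonneg _))
        (hcross k (mem_range.1 hk)).1
    · exact mul_pos (mul_pos (hw₁ i hi) (sq_pos_of_ne_zero hne.2))
        ((hcross i hi).2 hne.1)
  have h₄ : weightedSum N w₂ ((X - C (x j)) * f ^ 2) + weightedSum N w₂ (-((X - C (y j)) * f ^ 2)) =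
      (y j - x j) * weightedSum N w₂ (f ^ 2) := by
    have : (X - C (x j)) * f ^ 2 + -((X - C (y j)) * f ^ 2) = (y j - x j) • f ^ 2 := by
      rw [smul_eq_C_mul, C_sub]
      ring
    rw [← map_add, this, map_smul, smul_eq_mul]
  have h₅ : 0 ≤ weightedSum N w₂ (f ^ 2) := by
    rw [weightedSum_apply]
    refine sum_nonneg fun i hi => mul_nonneg (hw₂ i (mem_range.1 hi)).le ?_
    rw [eval_pow]
    positivity
  have h₆ : 0 < (y j - x j) * weightedSum N w₂ (f ^ 2) := by
    rw [← h₄]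
    nlinarith [mul_nonneg hc.le h₁]
  exact sub_pos.1 (pos_of_mul_pos_left h₆ h₅)

lemma poch_zero (a : ℝ) : poch a 0 = 1 := by simp [poch]

lemma poch_succ (a : ℝ) (k : ℕ) : poch a (k + 1) = poch a k * (a + k) := prod_range_succ _ _

lemma poch_add (a : ℝ) (k m : ℕ) : poch a (k + m) = poch a k * poch (a + k) m := by
  simp [poch, prod_range_add, add_assoc]

lemma poch_succ_left (a : ℝ) (k : ℕ) : poch a (k + 1) = a * poch (a + 1) k := by
  rw [add_comm, poch_add]
  simp [poch]

lemma poch_pos {a : ℝ} (ha : 0 < a) (k : ℕ) : 0 < poch a k :=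
  prod_pos fun _ _ => by positivity

lemma poch_zero_succ (k : ℕ) : poch 0 (k + 1) = 0 := by simp [poch_succ_left]

lemma eval_ascPochhammer_eq_poch (a : ℝ) (k : ℕ) : (ascPochhammer ℝ k).eval a = poch a k := by
  induction k with
  | zero => simp [poch_zero]
  | succ k ih => rw [ascPochhammer_succ_eval, ih, poch_succ]

lemma poch_neg_natCast_eq_zero {i k : ℕ} (h : i < k) : poch (-(i : ℝ)) k = 0 :=
  prod_eq_zero (mem_range.2 h) (by simp)

lemma poch_neg_natCast (k i : ℕ) :
    poch (-((k + i : ℕ) : ℝ)) k = (-1) ^ k * ((k + i).factorial / i.factorial) := by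
  induction k with
  | zero => simp [poch_zero, i.factorial_ne_zero]
  | succ k ih =>
    have : -((k + 1 + i : ℕ) : ℝ) + 1 = -((k + i : ℕ) : ℝ) := by push_cast; ring
    rw [poch_succ_left, this, ih, show k + 1 + i = (k + i) + 1 by ring, Nat.factorial_succ]
    push_cast
    ring

/-- The Chu–Vandermonde identity. -/
lemma sum_antidiagonal_poch (a b : ℝ) (L : ℕ) :
    ∑ p ∈ antidiagonal L, poch a p.1 / p.1.factorial * (poch b p.2 / p.2.factorial) =
      poch (a + b) L / L.factorial := by
  have hstep (c : ℝ) (i : ℕ) : ((i + 1 : ℕ) : ℝ) * (poch c (i + 1) / (i + 1).factorial) =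
      (c + i) * (poch c i / i.factorial) := by
    have := Nat.cast_ne_zero (R := ℝ).2 i.factorial_ne_zero
    rw [poch_succ, Nat.factorial_succ]
    push_cast
    field_simp
  induction L with
  | zero => simp [poch_zero]
  | succ L ih =>
    have hL : ((L + 1 : ℕ) : ℝ) ≠ 0 := by positivity
    apply mul_left_cancel₀ hL
    rw [hstep, ← ih, mul_sum, mul_sum]
    calc _ = ∑ p ∈ antidiagonal (L + 1),
            (((p.1 : ℝ) * (poch a p.1 / p.1.factorial)) * (poch b p.2 / p.2.factorial) +
              (poch a p.1 / p.1.factorial) * ((p.2 : ℝ) * (poch b p.2 / p.2.factorial))) := by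
          refine sum_congr rfl fun p hp => ?_
          rw [← mem_antidiagonal.1 hp]
          push_cast
          ring
      _ = ∑ p ∈ antidiagonal L, (((a + p.1) * (poch a p.1 / p.1.factorial)) *
              (poch b p.2 / p.2.factorial) + (poch a p.1 / p.1.factorial) *
                ((b + p.2) * (poch b p.2 / p.2.factorial))) := by
          rw [sum_add_distrib, sum_add_distrib, Nat.sum_antidiagonal_succ,
            Nat.sum_antidiagonal_succ']
          simp [← hstep]
      _ = _ := by
          refine sum_congr rfl fun p hp => ?_
          rw [← mem_antidiagonal.1 hp]
          push_cast
          ring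

/-- The weight on `{0, …, M}` for which the Hahn polynomials with `N = M + 1` are orthogonal. -/
noncomputable def hahnWeight (M : ℕ) (α β : ℝ) (i : ℕ) : ℝ :=
  poch (β + 1) i / i.factorial * (poch (α + 1) (M - i) / (M - i).factorial)

lemma hahnWeight_pos (M : ℕ) {α β : ℝ} (hα : -1 < α) (hβ : -1 < β) (i : ℕ) :
    0 < hahnWeight M α β i := by
  have := poch_pos (by linarith : 0 < α + 1) (M - i)
  have := poch_pos (by linarith : 0 < β + 1) i
  unfold hahnWeight
  positivity

lemma sum_hahnWeight_mul_poch {M k : ℕ} (hk : k ≤ M) (m : ℕ) (α β : ℝ) :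
    ∑ i ∈ range (M + 1), hahnWeight M α β i *
        (poch (-(i : ℝ)) k * poch (α + 1 + M - i) m) =
      (-1) ^ k * poch (β + 1) k * poch (α + 1) m *
        (poch (α + β + 2 + k + m) (M - k) / (M - k).factorial) := by
  obtain ⟨L, rfl⟩ := Nat.exists_eq_add_of_le hk
  rw [add_assoc, sum_range_add, sum_eq_zero fun i hi => ?_, zero_add]
  · rw [Nat.add_sub_cancel_left, show α + β + 2 + k + m = (β + 1 + k) + (α + 1 + m) by ring,
      ← sum_antidiagonal_poch, Nat.sum_antidiagonal_eq_sum_range_succ_mk, mul_sum]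
    refine sum_congr rfl fun i hi => ?_
    obtain ⟨j, rfl⟩ := Nat.exists_eq_add_of_le (mem_range_succ_iff.1 hi)
    have hα : poch (α + 1) j * poch (α + 1 + j) m = poch (α + 1) m * poch (α + 1 + m) j := by
      rw [← poch_add, ← poch_add, add_comm j m]
    have e : α + 1 + ((k + (i + j) : ℕ) : ℝ) - ((k + i : ℕ) : ℝ) = α + 1 + j := by
      push_cast; ring
    rw [hahnWeight, poch_neg_natCast, poch_add (β + 1) k i, e,
      show k + (i + j) - (k + i) = j by omega, show i + j - i = j by omega]
    have := Nat.cast_ne_zero (R := ℝ).2 (k + i).factorial_ne_zero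
    field_simp
    linear_combination (poch (β + 1) k * poch (β + 1 + k) i) * hα
  · rw [poch_neg_natCast_eq_zero (mem_range.1 hi), zero_mul, mul_zero]

lemma sum_neg_one_pow_mul_choose_mul_eval {n : ℕ} {P : ℝ[X]} (hP : P.natDegree < n) :
    ∑ k ∈ range (n + 1), (-1) ^ k * (n.choose k : ℝ) * P.eval (k : ℝ) = 0 := by
  have h := congrFun (fwdDiff_iter_eq_zero_of_degree_lt hP) 0
  rw [fwdDiff_iter_eq_sum_shift, Pi.zero_apply] at h
  have h' := congrArg (fun z => (-1 : ℝ) ^ n * z) h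
  simp only [mul_zero, mul_sum] at h'
  rw [← h']
  refine sum_congr rfl fun k hk => ?_
  obtain ⟨l, rfl⟩ := Nat.exists_eq_add_of_le (mem_range_succ_iff.1 hk)
  have : (-1 : ℝ) ^ l * (-1) ^ l = 1 := by rw [← mul_pow]; simp
  simp only [Nat.add_sub_cancel_left, zsmul_eq_mul, zero_add, nsmul_eq_mul, mul_one]
  push_cast
  rw [pow_add]
  linear_combination (-(-1) ^ k * ((k + l).choose k : ℝ) * P.eval (k : ℝ)) * this

/-- The coefficient of `(-x)_k` in the Hahn polynomial. -/
noncomputable def hahnCoeff (N n : ℕ) (α β : ℝ) (k : ℕ) : ℝ :=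
  poch (-(n : ℝ)) k * poch ((n : ℝ) + α + β + 1) k /
    (poch (β + 1) k * poch (1 - (N : ℝ)) k * (Nat.factorial k : ℝ))

/-- The Hahn polynomial as an element of `ℝ[X]`. -/
noncomputable def hahnPolynomial (N n : ℕ) (α β : ℝ) : ℝ[X] :=
  ∑ k ∈ range (n + 1), C (hahnCoeff N n α β k) * (ascPochhammer ℝ k).comp (-X)

lemma eval_hahnPolynomial (N n : ℕ) (α β x : ℝ) :
    (hahnPolynomial N n α β).eval x = hahnPoly N n α β x := by
  simp only [hahnPolynomial, hahnPoly, hahnCoeff, eval_finsetSum, eval_mul, eval_C, eval_comp,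
    eval_neg, eval_X, eval_ascPochhammer_eq_poch]
  exact sum_congr rfl fun k _ => by ring

lemma natDegree_hahnPolynomial_le (N n : ℕ) (α β : ℝ) :
    (hahnPolynomial N n α β).natDegree ≤ n := by
  refine natDegree_sum_le_of_forall_le _ _ fun k hk => (natDegree_C_mul_le _ _).trans ?_
  rw [natDegree_comp, ascPochhammer_natDegree, natDegree_neg, natDegree_X, mul_one]
  exact mem_range_succ_iff.1 hk

lemma hahnPolynomial_ne_zero (N n : ℕ) (α β : ℝ) : hahnPolynomial N n α β ≠ 0 := by
  intro h
  have h0 := congrArg (eval 0) h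
  rw [eval_hahnPolynomial, hahnPoly, sum_range_succ'] at h0
  simp [poch_zero, poch_zero_succ] at h0

/-- The shifted factorials `(a - x)_m`, as a sequence of polynomials in `x`. -/
noncomputable def reflectedPochhammer (a : ℝ) : Polynomial.Sequence ℝ where
  elems' m := (ascPochhammer ℝ m).comp (C a - X)
  degree_eq' m := by
    have h : (C a - X : ℝ[X]).natDegree = 1 := by
      rw [← natDegree_neg, neg_sub, natDegree_X_sub_C]
    have hcomp : ((ascPochhammer ℝ m).comp (C a - X)).natDegree = m := by
      rw [natDegree_comp, ascPochhammer_natDegree, h, mul_one]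
    rw [degree_eq_natDegree (fun h0 => ?_), hcomp]
    rcases comp_eq_zero_iff.1 h0 with h1 | ⟨_, h1⟩
    · exact (monic_ascPochhammer ℝ m).ne_zero h1
    · rw [h1, natDegree_C] at h
      exact zero_ne_one h

lemma eval_reflectedPochhammer (a x : ℝ) (m : ℕ) :
    ((reflectedPochhammer a) m).eval x = poch (a - x) m := by
  simp [reflectedPochhammer, eval_ascPochhammer_eq_poch]

lemma weightedSum_hahnPolynomial_mul_reflectedPochhammer {M n m : ℕ} (hnM : n ≤ M) (hm : m < n)
    {α β : ℝ} (hα : -1 < α) (hβ : -1 < β) :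
    weightedSum (M + 1) (hahnWeight M α β)
      (hahnPolynomial (M + 1) n α β * (reflectedPochhammer (α + 1 + M)) m) = 0 := by
  set b : ℝ := α + β + 2 + m with hb
  have hbpos : 0 < b := by
    have : (0 : ℝ) ≤ m := m.cast_nonneg
    linarith
  obtain ⟨d, hd⟩ : ∃ d, n = m + 1 + d := Nat.exists_eq_add_of_le hm
  have hterm (k : ℕ) (hk : k ∈ range (n + 1)) :
      weightedSum (M + 1) (hahnWeight M α β) (C (hahnCoeff (M + 1) n α β k) *
        (ascPochhammer ℝ k).comp (-X) * (reflectedPochhammer (α + 1 + M)) m) =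
      poch (α + 1) m * poch b M / (M.factorial * poch b d) *
        ((-1) ^ k * (n.choose k : ℝ) * ((ascPochhammer ℝ d).comp (X + C b)).eval (k : ℝ)) := by
    have hkn : k ≤ n := mem_range_succ_iff.1 hk
    have hkM : k ≤ M := hkn.trans hnM
    rw [mul_assoc, ← smul_eq_C_mul, map_smul, smul_eq_mul, weightedSum_apply]
    simp only [eval_mul, eval_comp, eval_neg, eval_X, eval_add, eval_C,
      eval_ascPochhammer_eq_poch, eval_reflectedPochhammer]
    rw [sum_hahnWeight_mul_poch hkM]
    have h1 : poch (1 - ((M + 1 : ℕ) : ℝ)) k =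
        (-1) ^ k * (M.factorial / (M - k).factorial) := by
      obtain ⟨l, rfl⟩ := Nat.exists_eq_add_of_le hkM
      rw [Nat.add_sub_cancel_left, ← poch_neg_natCast]
      congr 1
      push_cast
      ring
    have h2 : poch (-(n : ℝ)) k = (-1) ^ k * (k.factorial * n.choose k) := by
      obtain ⟨l, rfl⟩ := Nat.exists_eq_add_of_le hkn
      rw [poch_neg_natCast, Nat.cast_add_choose]
      have := Nat.cast_ne_zero (R := ℝ).2 k.factorial_ne_zero
      field_simp
    have h3 : poch b d * poch ((n : ℝ) + α + β + 1) k = poch b k * poch (k + b) d := by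
      have e1 : (n : ℝ) + α + β + 1 = b + d := by rw [hb, hd]; push_cast; ring
      rw [e1, add_comm (k : ℝ) b, ← poch_add, ← poch_add, add_comm]
    have h4 : poch b k * poch (α + β + 2 + k + m) (M - k) = poch b M := by
      rw [show α + β + 2 + k + m = b + k by rw [hb]; ring, ← poch_add, Nat.add_sub_cancel' hkM]
    have p1 := (poch_pos (by linarith : 0 < β + 1) k).ne'
    have p2 := (poch_pos hbpos d).ne'
    have p3 := (poch_pos hbpos k).ne'
    have f1 := Nat.cast_ne_zero (R := ℝ).2 k.factorial_ne_zero
    have f2 := Nat.cast_ne_zero (R := ℝ).2 M.factorial_ne_zero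
    have f3 := Nat.cast_ne_zero (R := ℝ).2 (M - k).factorial_ne_zero
    have h3' : poch ((n : ℝ) + α + β + 1) k = poch b k * poch (k + b) d / poch b d := by
      rw [eq_div_iff p2, ← h3, mul_comm]
    have s : ((-1 : ℝ) ^ k) ≠ 0 := pow_ne_zero _ (by norm_num)
    rw [hahnCoeff, h1, h2, h3', ← h4]
    field_simp
  rw [hahnPolynomial, sum_mul, map_sum, sum_congr rfl hterm, ← mul_sum,
    sum_neg_one_pow_mul_choose_mul_eval, mul_zero]
  rw [natDegree_comp, ascPochhammer_natDegree, natDegree_X_add_C]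
  omega

lemma weightedSum_hahnPolynomial_mul {M n : ℕ} (hnM : n ≤ M) {α β : ℝ} (hα : -1 < α)
    (hβ : -1 < β) {q : ℝ[X]} (hq : q.degree < n) :
    weightedSum (M + 1) (hahnWeight M α β) (hahnPolynomial (M + 1) n α β * q) = 0 := by
  have hspan := (reflectedPochhammer (α + 1 + M)).span_degreeLT (m := n)
    fun i _ => (leadingCoeff_ne_zero.2 ((reflectedPochhammer (α + 1 + M)).ne_zero i)).isUnit
  have hmem : q ∈ degreeLT ℝ n := mem_degreeLT.2 hq
  rw [← hspan] at hmem
  have hle : Submodule.span ℝ ((reflectedPochhammer (α + 1 + M)) '' Set.Iio n) ≤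
      LinearMap.ker (weightedSum (M + 1) (hahnWeight M α β) ∘ₗ
        LinearMap.mulLeft ℝ (hahnPolynomial (M + 1) n α β)) := by
    rw [Submodule.span_le]
    rintro _ ⟨m, hm, rfl⟩
    exact weightedSum_hahnPolynomial_mul_reflectedPochhammer hnM hm hα hβ
  exact hle hmem

lemma poch_ratio_lt {a b : ℝ} (ha : 0 < a) (hab : a < b) {i k : ℕ} (hik : i < k) :
    poch b i / poch a i < poch b k / poch a k := by
  refine strictMono_nat_of_lt_succ (f := fun i => poch b i / poch a i) (fun i => ?_) hik
  have h1 := poch_pos ha i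
  have h2 := poch_pos (ha.trans hab) i
  have h3 : 0 < a + i := by positivity
  simp only [poch_succ]
  rw [mul_div_mul_comm]
  refine lt_mul_of_one_lt_right (div_pos h2 h1) ?_
  rw [one_lt_div h3]
  linarith

lemma exists_hahn_zeros {M n : ℕ} (hnM : n ≤ M) {α β : ℝ} (hα : -1 < α) (hβ : -1 < β) :
    ∃ x : Fin n → ℝ, StrictMono x ∧ (∀ j, x j ∈ Set.Ioo (0 : ℝ) (((M + 1 : ℕ) : ℝ) - 1)) ∧
      (∀ y, hahnPoly (M + 1) n α β y = 0 ↔ ∃ j, y = x j) ∧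
      ∀ q : ℝ[X], q.degree < n →
        weightedSum (M + 1) (hahnWeight M α β) (Lagrange.nodal univ x * q) = 0 := by
  have hne := hahnPolynomial_ne_zero (M + 1) n α β
  obtain ⟨x, hx, hmem, c, hc⟩ := exists_zeros_of_orthogonal (Nat.lt_succ_of_le hnM)
    (fun i _ => hahnWeight_pos M hα hβ i) hne (natDegree_hahnPolynomial_le _ _ _ _)
    (fun q hq => weightedSum_hahnPolynomial_mul hnM hα hβ hq)
  have hc0 : c ≠ 0 := by
    rintro rfl
    simp [hc] at hne
  refine ⟨x, hx, hmem, fun y => ?_, fun q hq => ?_⟩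
  · rw [← eval_hahnPolynomial, hc, eval_mul, eval_C, Lagrange.eval_nodal]
    simp [hc0, prod_eq_zero_iff, sub_eq_zero]
  · have h := weightedSum_hahnPolynomial_mul hnM hα hβ hq
    rw [hc, mul_assoc, ← smul_eq_C_mul, map_smul, smul_eq_mul] at h
    exact (mul_eq_zero.1 h).resolve_left hc0

end

/-- zeros of Hahn polynomials: location and monotonicity in `α` and `β`. -/
theorem stmt_2 (N n : ℕ) (hN : 2 ≤ N) (hn : 1 ≤ n) (hnN : n ≤ N - 1) :
    ∃ x : ℝ → ℝ → Fin n → ℝ,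
      (∀ α β : ℝ, -1 < α → -1 < β →
        StrictMono (x α β) ∧
        (∀ j, x α β j ∈ Set.Ioo (0 : ℝ) ((N : ℝ) - 1)) ∧
        (∀ j, hahnPoly N n α β (x α β j) = 0) ∧
        (∀ y : ℝ, hahnPoly N n α β y = 0 → ∃ j, y = x α β j)) ∧
      (∀ β : ℝ, -1 < β → ∀ j, StrictAntiOn (fun α => x α β j) (Set.Ioi (-1))) ∧
      (∀ α : ℝ, -1 < α → ∀ j, StrictMonoOn (fun β => x α β j) (Set.Ioi (-1))) := by
  obtain ⟨M, rfl⟩ : ∃ M, N = M + 1 := ⟨N - 1, by omega⟩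
  have hnM : n ≤ M := hnN
  have key (α β : ℝ) : ∃ x : Fin n → ℝ, -1 < α → -1 < β → StrictMono x ∧
      (∀ j, x j ∈ Set.Ioo (0 : ℝ) (((M + 1 : ℕ) : ℝ) - 1)) ∧
      (∀ y, hahnPoly (M + 1) n α β y = 0 ↔ ∃ j, y = x j) ∧
      ∀ q : Polynomial ℝ, q.degree < n →
        weightedSum (M + 1) (hahnWeight M α β) (Lagrange.nodal Finset.univ x * q) = 0 := by
    by_cases h : -1 < α ∧ -1 < β
    · obtain ⟨x, hx⟩ := exists_hahn_zeros hnM h.1 h.2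
      exact ⟨x, fun _ _ => hx⟩
    · exact ⟨0, fun hα hβ => absurd ⟨hα, hβ⟩ h⟩
  choose x hx using key
  refine ⟨x, fun α β hα hβ => ?_, fun β hβ j α₁ hα₁ α₂ hα₂ hlt => ?_,
    fun α hα j β₁ hβ₁ β₂ hβ₂ hlt => ?_⟩
  · obtain ⟨hmono, hmem, hzero, -⟩ := hx α β hα hβ
    exact ⟨hmono, hmem, fun j => (hzero _).2 ⟨j, rfl⟩, fun y => (hzero y).1⟩
  · rw [Set.mem_Ioi] at hα₁ hα₂
    obtain ⟨hmono₁, -, -, horth₁⟩ := hx α₁ β hα₁ hβ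
    obtain ⟨hmono₂, hmem₂, -, horth₂⟩ := hx α₂ β hα₂ hβ
    have pos₁ (i : ℕ) := poch_pos (by linarith : 0 < α₁ + 1) i
    have pos₂ (i : ℕ) := poch_pos (by linarith : 0 < α₂ + 1) i
    refine zeros_lt_of_weight_ratio_strictMono (Nat.lt_succ_of_le hnM)
      (r := fun i => (poch (α₂ + 1) (M - i) / poch (α₁ + 1) (M - i))⁻¹)
      (fun i _ => hahnWeight_pos M hα₂ hβ i) (fun i hi k hk hik => ?_)
      (fun i _ => inv_pos.2 (div_pos (pos₂ _) (pos₁ _))) (fun i _ => ?_)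
      hmono₂ hmono₁ hmem₂ horth₂ horth₁ j
    · have hlt' : M - k < M - i := by rw [Set.mem_Iio] at hk; omega
      exact inv_strictAnti₀ (div_pos (pos₂ _) (pos₁ _))
        (poch_ratio_lt (by linarith) (by linarith) hlt')
    · have := (pos₁ (M - i)).ne'
      have := (pos₂ (M - i)).ne'
      simp only [hahnWeight]
      field_simp
  · rw [Set.mem_Ioi] at hβ₁ hβ₂
    obtain ⟨hmono₁, hmem₁, -, horth₁⟩ := hx α β₁ hα hβ₁
    obtain ⟨hmono₂, -, -, horth₂⟩ := hx α β₂ hα hβ₂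
    have pos₁ (i : ℕ) := poch_pos (by linarith : 0 < β₁ + 1) i
    have pos₂ (i : ℕ) := poch_pos (by linarith : 0 < β₂ + 1) i
    refine zeros_lt_of_weight_ratio_strictMono (Nat.lt_succ_of_le hnM)
      (r := fun i => poch (β₂ + 1) i / poch (β₁ + 1) i)
      (fun i _ => hahnWeight_pos M hα hβ₁ i)
      (fun i _ k _ hik => poch_ratio_lt (by linarith) (by linarith) hik)
      (fun i _ => div_pos (pos₂ _) (pos₁ _)) (fun i _ => ?_)
      hmono₁ hmono₂ hmem₁ horth₁ horth₂ j
    have := (pos₁ i).ne'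
    simp only [hahnWeight]
    field_simp
end

section
/- Fix integers N ≥ 2 and 1 ≤ n ≤ N-1. For 0 < α < 1, the Krawtchouk polynomial K_n^{(α)} has n distinct real zeros x_1(α) < ⋯ < x_n(α) in (0, N-1), and for each j ∈ {1,...,n} the zero x_j(α) is a strictly increasing function of α on (0, 1). -/
/-- Krawtchouk polynomial `K_n^{(α)}(x)`. -/
noncomputable def krawtchoukPoly (N n : ℕ) (α x : ℝ) : ℝ :=
  ∑ k ∈ Finset.range (n + 1),
    poch (-(n : ℝ)) k * poch (-x) k / (poch (1 - (N : ℝ)) k * (Nat.factorial k : ℝ)) *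
      (1 / α) ^ k

/-- The nodes `0, y 0, …, y (n - 1), b, b, …`. -/
noncomputable def withEndpoints (n : ℕ) (b : ℝ) (y : ℕ → ℝ) : ℕ → ℝ
  | 0 => 0
  | i + 1 => if i < n then y i else b

theorem withEndpoints_succ_of_lt {n i : ℕ} (b : ℝ) (y : ℕ → ℝ) (hi : i < n) :
    withEndpoints n b y (i + 1) = y i := if_pos hi

theorem withEndpoints_succ_self (n : ℕ) (b : ℝ) (y : ℕ → ℝ) :
    withEndpoints n b y (n + 1) = b := if_neg (lt_irrefl n)

theorem strictMonoOn_withEndpoints {n : ℕ} {b : ℝ} {y : ℕ → ℝ} (hb : 0 < b)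
    (hy : StrictMonoOn y (Set.Iio n)) (hy0 : ∀ i < n, y i ∈ Set.Ioo 0 b) :
    StrictMonoOn (withEndpoints n b y) (Set.Iic (n + 1)) := by
  rintro (_ | i) hi (_ | j) hj hij
  · exact absurd hij (lt_irrefl _)
  · simp only [withEndpoints]
    split_ifs with h
    · exact (hy0 j h).1
    · exact hb
  · simp at hij
  · simp only [Set.mem_Iic] at hi hj
    have hin : i < n := by omega
    simp only [withEndpoints, if_pos hin]
    split_ifs with h
    · exact hy hin h (by omega)
    · exact (hy0 i hin).2

/-- Sign of `∏ (y j - z)` when exactly the first `i` of the `y j` lie below `z`. -/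
theorem neg_one_pow_mul_prod_sub_pos {m i : ℕ} {y : ℕ → ℝ} {z : ℝ} (hi : i ≤ m)
    (hlt : ∀ j < i, y j < z) (hgt : ∀ j, i ≤ j → j < m → z < y j) :
    0 < (-1) ^ i * ∏ j ∈ Finset.range m, (y j - z) := by
  rw [← Finset.prod_range_mul_prod_Ico _ hi, ← mul_assoc]
  refine mul_pos ?_ (Finset.prod_pos fun j hj => ?_)
  · have h : ((-1 : ℝ)) ^ i * ∏ j ∈ Finset.range i, (y j - z)
        = ∏ j ∈ Finset.range i, (z - y j) := by
      rw [← Finset.card_range i, ← Finset.prod_const, Finset.card_range,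
        ← Finset.prod_mul_distrib]
      exact Finset.prod_congr rfl fun j _ => by ring
    rw [h]
    exact Finset.prod_pos fun j hj => sub_pos.2 (hlt j (Finset.mem_range.1 hj))
  · rw [Finset.mem_Ico] at hj
    exact sub_pos.2 (hgt j hj.1 hj.2)

/-- A polynomial of degree at most `m` alternating in sign at `m + 1` nodes has exactly one zero
between any two consecutive nodes, and no others. -/
theorem exists_zeros_of_alternating {m : ℕ} {P : Polynomial ℝ} (hP : P.natDegree ≤ m)
    {t : ℕ → ℝ} (ht : StrictMonoOn t (Set.Iic m))
    (hs : ∀ i ≤ m, 0 < (-1) ^ i * P.eval (t i)) :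
    ∃ y : ℕ → ℝ, StrictMonoOn y (Set.Iio m) ∧ (∀ i < m, y i ∈ Set.Ioo (t i) (t (i + 1))) ∧
      ∃ c > 0, ∀ z, P.eval z = c * ∏ i ∈ Finset.range m, (y i - z) := by
  have hroot : ∀ i, ∃ z, i < m → z ∈ Set.Ioo (t i) (t (i + 1)) ∧ P.eval z = 0 := by
    intro i
    by_cases hi : i < m
    · have hle : t i ≤ t (i + 1) := (ht (Set.mem_Iic.2 hi.le) (Set.mem_Iic.2 hi) i.lt_succ_self).le
      have hcont : ContinuousOn (fun z => (-1) ^ (i + 1) * P.eval z) (Set.Icc (t i) (t (i + 1))) := by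
        fun_prop
      have h0 := hs i hi.le
      have h1 := hs (i + 1) hi
      obtain ⟨z, hz, hz0⟩ := intermediate_value_Ioo hle hcont
        (show (0 : ℝ) ∈ Set.Ioo _ _ from ⟨by rw [pow_succ]; linarith, h1⟩)
      exact ⟨z, fun _ => ⟨hz, by simpa using hz0⟩⟩
    · exact ⟨0, fun h => absurd h hi⟩
  choose y hy using hroot
  have hmono : StrictMonoOn y (Set.Iio m) := by
    intro i hi j hj hij
    rw [Set.mem_Iio] at hi hj
    exact (hy i hi).1.2.trans_le ((ht.monotoneOn (Set.mem_Iic.2 hi) (Set.mem_Iic.2 hj.le) hij).trans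
      (hy j hj).1.1.le)
  refine ⟨y, hmono, fun i hi => (hy i hi).1, ?_⟩
  have hdvd : ∏ i ∈ Finset.range m, (Polynomial.X - Polynomial.C (y i)) ∣ P := by
    refine Finset.prod_dvd_of_coprime (fun i hi j hj hij => ?_) fun i hi => ?_
    · exact Polynomial.isCoprime_X_sub_C_of_isUnit_sub (sub_ne_zero.2 fun h => hij
        (hmono.injOn (by simpa using hi) (by simpa using hj) h)).isUnit
    · exact Polynomial.dvd_iff_isRoot.2 (hy i (Finset.mem_range.1 hi)).2
  obtain ⟨R, hR⟩ := hdvd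
  have hP0 : P ≠ 0 := by
    rintro rfl
    simpa using hs 0 m.zero_le
  have hR0 : R ≠ 0 := right_ne_zero_of_mul (hR ▸ hP0)
  have hmonic := Polynomial.monic_prod_of_monic (Finset.range m)
    (fun i => Polynomial.X - Polynomial.C (y i)) fun i _ => Polynomial.monic_X_sub_C _
  have hdeg : R.natDegree = 0 := by
    have h := hmonic.natDegree_mul' hR0
    rw [← hR, Polynomial.natDegree_prod_of_monic _ _ fun i _ => Polynomial.monic_X_sub_C _] at h
    simp at h
    omega
  rw [Polynomial.eq_C_of_natDegree_eq_zero hdeg] at hR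
  have heval : ∀ z, P.eval z
      = (R.coeff 0 * (-1) ^ m) * ∏ i ∈ Finset.range m, (y i - z) := by
    intro z
    have h : ∏ i ∈ Finset.range m, (z - y i) = (-1) ^ m * ∏ i ∈ Finset.range m, (y i - z) := by
      rw [← Finset.card_range m, ← Finset.prod_const, Finset.card_range, ← Finset.prod_mul_distrib]
      exact Finset.prod_congr rfl fun j _ => by ring
    rw [hR]
    simp only [Polynomial.eval_mul, Polynomial.eval_prod, Polynomial.eval_sub, Polynomial.eval_X,
      Polynomial.eval_C, h]
    ring
  refine ⟨_, ?_, heval⟩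
  have hpos : 0 < ∏ i ∈ Finset.range m, (y i - t 0) := Finset.prod_pos fun i hi => by
    have hi := Finset.mem_range.1 hi
    exact sub_pos.2 ((ht.monotoneOn (Set.mem_Iic.2 m.zero_le) (Set.mem_Iic.2 hi.le)
      i.zero_le).trans_lt (hy i hi).1.1)
  have h0 := hs 0 m.zero_le
  rw [heval, pow_zero, one_mul] at h0
  exact pos_of_mul_pos_left h0 hpos.le

/-- A function that is locally strictly increasing on both sides of every point of a preconnected
set is strictly increasing there. -/
theorem strictMonoOn_of_eventually_lt {f : ℝ → ℝ} {s : Set ℝ} (hs : s.OrdConnected)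
    (hr : ∀ a ∈ s, ∀ᶠ b in nhdsWithin a (Set.Ioi a), b ∈ s → f a < f b)
    (hl : ∀ a ∈ s, ∀ᶠ b in nhdsWithin a (Set.Iio a), b ∈ s → f b < f a) :
    StrictMonoOn f s := by
  intro a ha b hb hab
  have hsub : Set.Icc a b ⊆ s := hs.out ha hb
  set S := {t ∈ Set.Icc a b | ∀ r ∈ Set.Ioc a t, f a < f r}
  have haS : a ∈ S := ⟨⟨le_rfl, hab.le⟩, fun r hr => absurd hr.1 (not_lt.2 hr.2)⟩
  have hbdd : BddAbove S := ⟨b, fun t ht => ht.1.2⟩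
  set c := sSup S
  have hac : a ≤ c := le_csSup hbdd haS
  have hcb : c ≤ b := csSup_le ⟨a, haS⟩ fun t ht => ht.1.2
  have hbelow : ∀ r ∈ Set.Ioo a c, f a < f r := by
    intro r hr
    obtain ⟨t, htS, hrt⟩ := exists_lt_of_lt_csSup ⟨a, haS⟩ hr.2
    exact htS.2 r ⟨hr.1, hrt.le⟩
  have hcS : c ∈ S := by
    refine ⟨⟨hac, hcb⟩, fun r hr => ?_⟩
    rcases hr.2.lt_or_eq with h | rfl
    · exact hbelow r ⟨hr.1, h⟩
    · have hmem : ∀ᶠ x in nhdsWithin c (Set.Iio c), x ∈ Set.Ioo a c := Ioo_mem_nhdsLT hr.1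
      obtain ⟨x, hx, hx'⟩ := ((hl c (hsub ⟨hac, hcb⟩)).and hmem).exists
      exact (hbelow x hx').trans (hx (hsub ⟨hx'.1.le, hx'.2.le.trans hcb⟩))
  rcases hcb.lt_or_eq with hlt | heq
  · exfalso
    have hcle : ∀ r ∈ Set.Ioc a c, f a < f r := hcS.2
    obtain ⟨u, hu, hu'⟩ := (mem_nhdsGT_iff_exists_Ioo_subset' hlt).1 (hr c (hsub ⟨hac, hcb⟩))
    obtain ⟨v, hv, hv'⟩ := exists_between (lt_min hu hlt)
    have hvS : v ∈ S := by
      refine ⟨⟨hac.trans hv.le, (hv'.trans_le (min_le_right _ _)).le⟩, fun r hr' => ?_⟩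
      rcases le_or_gt r c with h | h
      · exact hcle r ⟨hr'.1, h⟩
      · have h1 : f c < f r := hu' ⟨h, hr'.2.trans_lt (hv'.trans_le (min_le_left _ _))⟩
          (hsub ⟨hr'.1.le, hr'.2.trans (hv'.trans_le (min_le_right _ _)).le⟩)
        rcases hac.eq_or_lt with h2 | h2
        · rwa [← h2] at h1
        · exact (hcle c ⟨h2, le_rfl⟩).trans h1
    exact absurd (le_csSup hbdd hvS) (not_le.2 hv)
  · exact hcS.2 b ⟨hab, heq.ge⟩

open Polynomial in
theorem LinearMap.eq_of_natDegree_lt_of_eq_X_pow {R E : Type*} [CommRing R] [AddCommGroup E]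
    [Module R E] {A B : R[X] →ₗ[R] E} {m : ℕ} (h : ∀ k < m, A (X ^ k) = B (X ^ k)) {p : R[X]}
    (hp : p.natDegree < m) : A p = B p := by
  rw [p.as_sum_range' m hp, map_sum, map_sum]
  refine Finset.sum_congr rfl fun k hk => ?_
  rw [← C_mul_X_pow_eq_monomial, ← smul_eq_C_mul, map_smul, map_smul, h k (Finset.mem_range.1 hk)]

/-- The normalized falling factorial `(-1)^k x(x-1)⋯(x-k+1) / (M(M-1)⋯(M-k+1))`. -/
noncomputable def krawtchoukMoment (M : ℕ) (x : ℝ) (k : ℕ) : ℝ :=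
  (-1) ^ k * ∏ j ∈ Finset.range k, (x - j) / ((M : ℝ) - j)

/-- The Krawtchouk polynomial on `{0, …, M}` multiplied by `α ^ n`. -/
noncomputable def scaledKrawtchouk (M n : ℕ) (α x : ℝ) : ℝ :=
  ∑ k ∈ Finset.range (n + 1), n.choose k * α ^ (n - k) * krawtchoukMoment M x k

theorem poch_neg_natCast_s4 (n k : ℕ) :
    poch (-(n : ℝ)) k = (-1) ^ k * (k.factorial * n.choose k : ℝ) := by
  have h : (∏ j ∈ Finset.range k, ((n : ℝ) - j)) = k.factorial * n.choose k := by
    rw [← Nat.cast_mul, ← Nat.descFactorial_eq_factorial_mul_choose]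
    rw [← descPochhammer_eval_eq_descFactorial, descPochhammer_eval_eq_prod_range]
  rw [← h, poch]
  conv_rhs => rw [← Finset.card_range k, ← Finset.prod_const, Finset.card_range,
    ← Finset.prod_mul_distrib]
  exact Finset.prod_congr rfl fun j _ => by ring

theorem scaledKrawtchouk_eq (M n : ℕ) {α : ℝ} (hα : α ≠ 0) (x : ℝ) :
    scaledKrawtchouk M n α x = α ^ n * krawtchoukPoly (M + 1) n α x := by
  rw [scaledKrawtchouk, krawtchoukPoly, Finset.mul_sum]
  refine Finset.sum_congr rfl fun k hk => ?_
  have hk : k ≤ n := Nat.lt_succ_iff.1 (Finset.mem_range.1 hk)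
  have h : poch (-x) k / poch (1 - ((M + 1 : ℕ) : ℝ)) k
      = ∏ j ∈ Finset.range k, (x - j) / ((M : ℝ) - j) := by
    rw [poch, poch, ← Finset.prod_div_distrib]
    refine Finset.prod_congr rfl fun j _ => ?_
    rw [← neg_div_neg_eq]
    push_cast
    congr 1 <;> ring
  have hf : (k.factorial : ℝ) ≠ 0 := by positivity
  rw [krawtchoukMoment, ← h, poch_neg_natCast_s4, pow_sub₀ _ hα hk, one_div, inv_pow]
  field_simp

theorem krawtchoukMoment_succ {M k : ℕ} (hk : k < M) (x : ℝ) :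
    ((M : ℝ) - k) * krawtchoukMoment M x (k + 1) = (k - x) * krawtchoukMoment M x k := by
  have h : (M : ℝ) - k ≠ 0 := sub_ne_zero.2 (by exact_mod_cast hk.ne')
  rw [krawtchoukMoment, krawtchoukMoment, Finset.prod_range_succ]
  field_simp
  ring

/-- The linear functional sending `X ^ k` to `krawtchoukMoment M x k`. -/
noncomputable def krawtchoukFunctional (M : ℕ) (x : ℝ) : Polynomial ℝ →ₗ[ℝ] ℝ :=
  Polynomial.lsum fun k => krawtchoukMoment M x k • LinearMap.id

theorem krawtchoukFunctional_X_pow (M : ℕ) (x : ℝ) (k : ℕ) :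
    krawtchoukFunctional M x (Polynomial.X ^ k) = krawtchoukMoment M x k := by
  rw [krawtchoukFunctional, Polynomial.X_pow_eq_monomial, Polynomial.lsum_apply,
    Polynomial.sum_monomial_index] <;> simp

theorem krawtchoukFunctional_X_add_C_pow (M n : ℕ) (α x : ℝ) :
    krawtchoukFunctional M x ((Polynomial.X + Polynomial.C α) ^ n) = scaledKrawtchouk M n α x := by
  rw [add_pow, map_sum, scaledKrawtchouk]
  refine Finset.sum_congr rfl fun k _ => ?_
  have h : (Polynomial.X : Polynomial ℝ) ^ k * Polynomial.C α ^ (n - k) * (n.choose k : Polynomial ℝ)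
      = (n.choose k * α ^ (n - k) : ℝ) • Polynomial.X ^ k := by
    rw [Polynomial.smul_eq_C_mul]
    simp only [map_mul, map_pow, map_natCast]
    ring
  rw [h, map_smul, krawtchoukFunctional_X_pow, smul_eq_mul]

open Polynomial in
theorem krawtchoukFunctional_mul {M : ℕ} (x : ℝ) {p : ℝ[X]} (hp : p.natDegree < M) :
    x * krawtchoukFunctional M x p
      = krawtchoukFunctional M x ((X + X ^ 2) * derivative p - C (M : ℝ) * X * p) := by
  let A : ℝ[X] →ₗ[ℝ] ℝ := x • krawtchoukFunctional M x
  let B : ℝ[X] →ₗ[ℝ] ℝ := krawtchoukFunctional M x ∘ₗ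
    (LinearMap.mulLeft ℝ (X + X ^ 2) ∘ₗ derivative - LinearMap.mulLeft ℝ (C (M : ℝ) * X))
  have h : A p = B p := by
    refine LinearMap.eq_of_natDegree_lt_of_eq_X_pow (fun k hk => ?_) hp
    have hX : (X + X ^ 2) * derivative (X ^ k) - C (M : ℝ) * X * X ^ k
        = (k : ℝ) • X ^ k + ((k : ℝ) - M) • (X : ℝ[X]) ^ (k + 1) := by
      rw [derivative_X_pow]
      simp only [smul_eq_C_mul, map_sub]
      cases k <;> simp
      ring
    change x * krawtchoukFunctional M x (X ^ k)
      = krawtchoukFunctional M x ((X + X ^ 2) * derivative (X ^ k) - C (M : ℝ) * X * X ^ k)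
    rw [hX, map_add, map_smul, map_smul, krawtchoukFunctional_X_pow, krawtchoukFunctional_X_pow,
      smul_eq_mul, smul_eq_mul]
    linear_combination krawtchoukMoment_succ hk x
  exact h

open Polynomial in
theorem scaledKrawtchouk_recurrence {M n : ℕ} (hn : n < M) (α x : ℝ) :
    ((M : ℝ) - n) * scaledKrawtchouk M (n + 1) α x
      = (α * (M - n) + n * (1 - α) - x) * scaledKrawtchouk M n α x
        - n * α * (1 - α) * scaledKrawtchouk M (n - 1) α x := by
  have hdeg : ((X + C α) ^ n).natDegree < M := by simpa using hn
  have h := krawtchoukFunctional_mul x hdeg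
  have hX : (X + X ^ 2) * derivative ((X + C α) ^ n) - C (M : ℝ) * X * (X + C α) ^ n
      = ((n : ℝ) - M) • (X + C α) ^ (n + 1) + (n * (1 - 2 * α) + M * α) • (X + C α) ^ n
        + (-(n * α * (1 - α))) • (X + C α) ^ (n - 1) := by
    simp only [smul_eq_C_mul, map_sub, map_add, map_mul, map_neg, map_one, map_natCast, map_ofNat]
    rcases n with _ | n
    · simp
      ring
    · simp [derivative_X_add_C_pow]
      ring
  rw [hX, map_add, map_add, map_smul, map_smul, map_smul] at h
  simp only [krawtchoukFunctional_X_add_C_pow, smul_eq_mul] at h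
  linear_combination h

theorem scaledKrawtchouk_zero_right (M n : ℕ) (α : ℝ) : scaledKrawtchouk M n α 0 = α ^ n := by
  rw [scaledKrawtchouk, Finset.sum_eq_single 0]
  · simp [krawtchoukMoment]
  · intro k _ hk
    rw [krawtchoukMoment, Finset.prod_eq_zero (Finset.mem_range.2 (Nat.pos_of_ne_zero hk))] <;> simp
  · simp

theorem scaledKrawtchouk_natCast_right {M n : ℕ} (hn : n ≤ M) (α : ℝ) :
    scaledKrawtchouk M n α M = (α - 1) ^ n := by
  rw [sub_eq_add_neg, add_comm, add_pow, scaledKrawtchouk]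
  refine Finset.sum_congr rfl fun k hk => ?_
  have hprod : ∏ j ∈ Finset.range k, ((M : ℝ) - j) / ((M : ℝ) - j) = 1 := by
    refine Finset.prod_eq_one fun j hj => div_self (sub_ne_zero.2 ?_)
    rw [Finset.mem_range] at hk hj
    exact_mod_cast (by omega : M ≠ j)
  rw [krawtchoukMoment, hprod]
  ring

theorem exists_polynomial_eval_eq_scaledKrawtchouk (M n : ℕ) (α : ℝ) :
    ∃ P : Polynomial ℝ, P.natDegree ≤ n ∧ ∀ x, P.eval x = scaledKrawtchouk M n α x := by
  refine ⟨∑ k ∈ Finset.range (n + 1), Polynomial.C (n.choose k * α ^ (n - k) * (-1) ^ k *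
    ∏ j ∈ Finset.range k, ((M : ℝ) - j)⁻¹) *
      ∏ j ∈ Finset.range k, (Polynomial.X - Polynomial.C (j : ℝ)), ?_, fun x => ?_⟩
  · refine Polynomial.natDegree_sum_le_of_forall_le _ _ fun k hk => ?_
    refine (Polynomial.natDegree_C_mul_le _ _).trans ?_
    rw [Polynomial.natDegree_prod_of_monic _ _ fun i _ => Polynomial.monic_X_sub_C _]
    simpa only [Polynomial.natDegree_X_sub_C, Finset.sum_const, Finset.card_range, smul_eq_mul,
      mul_one, Nat.lt_succ_iff, Finset.mem_range] using hk
  · rw [Polynomial.eval_finsetSum, scaledKrawtchouk]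
    refine Finset.sum_congr rfl fun k _ => ?_
    simp only [krawtchoukMoment, Polynomial.eval_mul, Polynomial.eval_C, Polynomial.eval_prod,
      Polynomial.eval_sub, Polynomial.eval_X, div_eq_mul_inv, Finset.prod_mul_distrib]
    ring

theorem hasDerivAt_scaledKrawtchouk (M n : ℕ) (α x : ℝ) :
    HasDerivAt (fun α => scaledKrawtchouk M n α x) (n * scaledKrawtchouk M (n - 1) α x) α := by
  rcases n with _ | n
  · simpa [scaledKrawtchouk] using hasDerivAt_const α (krawtchoukMoment M x 0)
  have h : HasDerivAt (fun α => scaledKrawtchouk M (n + 1) α x)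
      (∑ k ∈ Finset.range (n + 2), (n + 1).choose k *
        (((n + 1 - k : ℕ) : ℝ) * α ^ (n + 1 - k - 1)) * krawtchoukMoment M x k) α :=
    HasDerivAt.fun_sum fun k _ => ((hasDerivAt_pow _ α).const_mul _).mul_const _
  convert h using 1
  rw [Finset.sum_range_succ, scaledKrawtchouk, Finset.mul_sum]
  simp only [Nat.sub_self, Nat.cast_zero, zero_mul, mul_zero, add_zero, Nat.add_sub_cancel]
  refine Finset.sum_congr rfl fun k _ => ?_
  have hc : (n.choose k : ℝ) * (n + 1) = (n + 1).choose k * ((n + 1 - k : ℕ) : ℝ) := by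
    exact_mod_cast Nat.choose_mul_succ_eq n k
  rw [show n + 1 - k - 1 = n - k by omega]
  push_cast
  linear_combination (α ^ (n - k) * krawtchoukMoment M x k) * hc

/-- The scaled Krawtchouk polynomial factors over `n` zeros in `(0, M)`, which separate the signs
of its predecessor. -/
theorem exists_zeros_scaledKrawtchouk {M : ℕ} {α : ℝ} (h0 : 0 < α) (h1 : α < 1) {n : ℕ}
    (hn : n ≤ M) :
    ∃ y : ℕ → ℝ, StrictMonoOn y (Set.Iio n) ∧ (∀ i < n, y i ∈ Set.Ioo 0 (M : ℝ)) ∧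
      (∃ c > 0, ∀ z, scaledKrawtchouk M n α z = c * ∏ i ∈ Finset.range n, (y i - z)) ∧
      ∀ i < n, 0 < (-1) ^ i * scaledKrawtchouk M (n - 1) α (y i) := by
  induction n with
  | zero =>
    exact ⟨fun _ => 0, fun i hi => by simp at hi, by simp,
      ⟨1, one_pos, by simp [scaledKrawtchouk, krawtchoukMoment]⟩, by simp⟩
  | succ n ih =>
    obtain ⟨y, hy, hyM, ⟨c, hc, hfac⟩, hsign⟩ := ih (Nat.le_of_succ_le hn)
    have hMn : (0 : ℝ) < M - n := sub_pos.2 (by exact_mod_cast hn)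
    have hM : (0 : ℝ) < M := by exact_mod_cast n.zero_le.trans_lt hn
    obtain ⟨P, hdeg, hP⟩ := exists_polynomial_eval_eq_scaledKrawtchouk M (n + 1) α
    set t := withEndpoints n M y with ht_def
    have ht : StrictMonoOn t (Set.Iic (n + 1)) := strictMonoOn_withEndpoints hM hy hyM
    have hts : ∀ i < n, t (i + 1) = y i := fun i hi => withEndpoints_succ_of_lt _ _ hi
    obtain ⟨w, hw, hwt, hwfac⟩ := exists_zeros_of_alternating hdeg ht (fun i hi => by
      rw [hP]
      rcases i with _ | i
      · simpa [ht_def, withEndpoints, scaledKrawtchouk_zero_right] using pow_pos h0 _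
      · rcases lt_or_ge i n with hin | hin
        · rw [hts i hin]
          have hz : scaledKrawtchouk M n α (y i) = 0 := by
            rw [hfac, Finset.prod_eq_zero (Finset.mem_range.2 hin) (sub_self _), mul_zero]
          have hrec := scaledKrawtchouk_recurrence hn α (y i)
          rw [hz] at hrec
          have hn0 : (0 : ℝ) < n := by exact_mod_cast i.zero_le.trans_lt hin
          have hpos := mul_pos (mul_pos (mul_pos hn0 h0) (sub_pos.2 h1)) (hsign i hin)
          refine pos_of_mul_pos_right (a := (M : ℝ) - n) ?_ hMn.le
          rw [pow_succ]
          linear_combination hpos + (-1) ^ i * hrec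
        · obtain rfl : i = n := by omega
          rw [ht_def, withEndpoints_succ_self, scaledKrawtchouk_natCast_right hn, ← mul_pow]
          exact pow_pos (by linarith) _)
    simp only [hP] at hwfac
    have htIcc : ∀ i ≤ n + 1, t i ∈ Set.Icc 0 (M : ℝ) := fun i hi => by
      have h0' : t 0 = 0 := rfl
      have h1' : t (n + 1) = M := withEndpoints_succ_self _ _ _
      rw [← h0', ← h1']
      exact ⟨ht.monotoneOn (Set.mem_Iic.2 (Nat.zero_le _)) hi i.zero_le,
        ht.monotoneOn hi (Set.mem_Iic.2 le_rfl) hi⟩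
    refine ⟨w, hw, fun i hi => ⟨(htIcc i hi.le).1.trans_lt (hwt i hi).1,
      (hwt i hi).2.trans_le (htIcc (i + 1) hi).2⟩, hwfac, fun i hi => ?_⟩
    rw [Nat.add_sub_cancel, hfac, mul_left_comm]
    refine mul_pos hc (neg_one_pow_mul_prod_sub_pos (Nat.lt_succ_iff.1 hi) (fun j hj => ?_)
      fun j hij hj => ?_)
    · rw [← hts j (by omega)]
      exact (ht.monotoneOn (Set.mem_Iic.2 (by omega)) (Set.mem_Iic.2 hi.le) hj).trans_lt
        (hwt i hi).1
    · rw [← hts j hj]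
      exact (hwt i hi).2.trans_le
        (ht.monotoneOn (Set.mem_Iic.2 hi) (Set.mem_Iic.2 (by omega)) (by omega))

theorem eq_of_prod_range_sub_eq {n : ℕ} {y w : ℕ → ℝ} {c d : ℝ} (hy : StrictMonoOn y (Set.Iio n))
    (hw : StrictMonoOn w (Set.Iio n)) (hc : c ≠ 0) (hd : d ≠ 0)
    (h : ∀ z, c * ∏ i ∈ Finset.range n, (y i - z) = d * ∏ i ∈ Finset.range n, (w i - z))
    {i : ℕ} (hi : i < n) : y i = w i := by
  have hset : ∀ z, (∃ i : Fin n, y i = z) ↔ ∃ i : Fin n, w i = z := fun z => by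
    have hzero : ∀ {v : ℕ → ℝ}, (∃ i : Fin n, v i = z) ↔ ∏ i ∈ Finset.range n, (v i - z) = 0 := by
      intro v
      simp [Finset.prod_eq_zero_iff, sub_eq_zero, Fin.exists_iff]
    rw [hzero, hzero, ← mul_eq_zero_iff_left hc, h, mul_eq_zero_iff_left hd]
  have hrange : Set.range (fun i : Fin n => y i) = Set.range fun i : Fin n => w i := Set.ext hset
  have hmono : ∀ {v : ℕ → ℝ}, StrictMonoOn v (Set.Iio n) → StrictMono fun i : Fin n => v i :=
    fun hv a b hab => hv a.2 b.2 hab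
  exact congrFun (((hmono hy).range_inj (hmono hw)).1 hrange) ⟨i, hi⟩

/-- If a differentiable function vanishes at `a` with positive derivative, it is positive just
after `a` and negative just before. -/
theorem HasDerivAt.eventually_pos_and_neg {f : ℝ → ℝ} {f' a : ℝ} (hf : HasDerivAt f f' a)
    (ha : f a = 0) (hf' : 0 < f') :
    (∀ᶠ b in nhdsWithin a (Set.Ioi a), 0 < f b) ∧ ∀ᶠ b in nhdsWithin a (Set.Iio a), f b < 0 := by
  have hslope : ∀ᶠ b in nhdsWithin a {a}ᶜ, 0 < slope f a b :=
    (hasDerivAt_iff_tendsto_slope.1 hf).eventually (lt_mem_nhds hf')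
  constructor
  · filter_upwards [hslope.filter_mono (nhdsWithin_mono a fun b (hb : a < b) => hb.ne'),
      self_mem_nhdsWithin] with b hb hab
    rw [slope_def_field, ha, sub_zero] at hb
    exact (div_pos_iff_of_pos_right (sub_pos.2 hab)).1 hb
  · filter_upwards [hslope.filter_mono (nhdsWithin_mono a fun b (hb : b < a) => hb.ne),
      self_mem_nhdsWithin] with b hb hab
    rw [slope_def_field, ha, sub_zero] at hb
    by_contra! h
    exact absurd hb (not_lt.2 (div_nonpos_of_nonneg_of_nonpos h (sub_nonpos.2 (le_of_lt hab))))

/-- If the scaled Krawtchouk polynomial alternates in sign at the nodes `t`, its zeros `y`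
interlace with these nodes. -/
theorem mem_Ioo_of_scaledKrawtchouk_alternating {M n : ℕ} {α c : ℝ} {y t : ℕ → ℝ}
    (hy : StrictMonoOn y (Set.Iio n)) (hc : 0 < c)
    (hfac : ∀ z, scaledKrawtchouk M n α z = c * ∏ i ∈ Finset.range n, (y i - z))
    (ht : StrictMonoOn t (Set.Iic n))
    (hs : ∀ i ≤ n, 0 < (-1) ^ i * scaledKrawtchouk M n α (t i)) {i : ℕ} (hi : i < n) :
    y i ∈ Set.Ioo (t i) (t (i + 1)) := by
  obtain ⟨P, hdeg, hP⟩ := exists_polynomial_eval_eq_scaledKrawtchouk M n α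
  obtain ⟨w, hw, hwt, d, hd, hwfac⟩ := exists_zeros_of_alternating hdeg ht (by simpa only [hP])
  rw [eq_of_prod_range_sub_eq hy hw hc.ne' hd.ne' (fun z => by rw [← hfac, ← hwfac, hP]) hi]
  exact hwt i hi

/-- zeros of Krawtchouk polynomials: location and monotonicity in `α`. -/
theorem stmt_4 (N n : ℕ) (hN : 2 ≤ N) (hn : 1 ≤ n) (hnN : n ≤ N - 1) :
    ∃ x : ℝ → Fin n → ℝ,
      (∀ α : ℝ, 0 < α → α < 1 →
        StrictMono (x α) ∧
        (∀ j, x α j ∈ Set.Ioo (0 : ℝ) ((N : ℝ) - 1)) ∧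
        (∀ j, krawtchoukPoly N n α (x α j) = 0) ∧
        (∀ y : ℝ, krawtchoukPoly N n α y = 0 → ∃ j, y = x α j)) ∧
      (∀ j, StrictMonoOn (fun α => x α j) (Set.Ioo (0 : ℝ) 1)) := by
  obtain ⟨M, rfl⟩ : ∃ M, N = M + 1 := ⟨N - 1, by omega⟩
  rw [Nat.add_sub_cancel] at hnN
  have hM : (0 : ℝ) < M := by exact_mod_cast hn.trans hnN
  have hex : ∀ α : ℝ, ∃ y : ℕ → ℝ, 0 < α → α < 1 →
      StrictMonoOn y (Set.Iio n) ∧ (∀ i < n, y i ∈ Set.Ioo 0 (M : ℝ)) ∧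
      (∃ c > 0, ∀ z, scaledKrawtchouk M n α z = c * ∏ i ∈ Finset.range n, (y i - z)) ∧
      ∀ i < n, 0 < (-1) ^ i * scaledKrawtchouk M (n - 1) α (y i) := by
    intro α
    by_cases h : 0 < α ∧ α < 1
    · obtain ⟨y, hy⟩ := exists_zeros_scaledKrawtchouk h.1 h.2 hnN
      exact ⟨y, fun _ _ => hy⟩
    · exact ⟨0, fun h0 h1 => absurd ⟨h0, h1⟩ h⟩
  choose x hx using hex
  have hzero : ∀ α, 0 < α → α < 1 → ∀ i < n, scaledKrawtchouk M n α (x α i) = 0 := by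
    intro α h0 h1 i hi
    obtain ⟨-, -, ⟨c, -, hfac⟩, -⟩ := hx α h0 h1
    rw [hfac, Finset.prod_eq_zero (Finset.mem_range.2 hi) (sub_self _), mul_zero]
  refine ⟨fun α j => x α j, fun α h0 h1 => ?_, fun j => ?_⟩
  · obtain ⟨hmono, hmem, ⟨c, hc, hfac⟩, -⟩ := hx α h0 h1
    refine ⟨fun i j hij => hmono i.2 j.2 hij, fun j => ?_, fun j => ?_, fun z hz => ?_⟩
    · simpa using hmem j j.2
    · have h := hzero α h0 h1 j j.2
      rw [scaledKrawtchouk_eq M n h0.ne'] at h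
      exact (mul_eq_zero.1 h).resolve_left (pow_pos h0 n).ne'
    · have h := hfac z
      rw [scaledKrawtchouk_eq M n h0.ne', hz, mul_zero, eq_comm, mul_eq_zero_iff_left hc.ne',
        Finset.prod_eq_zero_iff] at h
      obtain ⟨i, hi, hiz⟩ := h
      exact ⟨⟨i, Finset.mem_range.1 hi⟩, (sub_eq_zero.1 hiz).symm⟩
  · have hsigns : ∀ α ∈ Set.Ioo (0 : ℝ) 1,
        (∀ᶠ β in nhdsWithin α (Set.Ioi α), ∀ i ∈ Set.Iio n,
          0 < (-1) ^ i * scaledKrawtchouk M n β (x α i)) ∧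
        ∀ᶠ β in nhdsWithin α (Set.Iio α), ∀ i ∈ Set.Iio n,
          (-1) ^ i * scaledKrawtchouk M n β (x α i) < 0 := by
      intro α hα
      have hn0 : (0 : ℝ) < n := by exact_mod_cast hn
      have h : ∀ i ∈ Set.Iio n, _ := fun i hi =>
        ((hasDerivAt_scaledKrawtchouk M n α (x α i)).const_mul ((-1) ^ i)).eventually_pos_and_neg
          (by rw [hzero α hα.1 hα.2 i hi, mul_zero])
          (by rw [mul_left_comm]; exact mul_pos hn0 ((hx α hα.1 hα.2).2.2.2 i hi))
      exact ⟨(Filter.eventually_all_finite (Set.finite_Iio n)).2 fun i hi => (h i hi).1,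
        (Filter.eventually_all_finite (Set.finite_Iio n)).2 fun i hi => (h i hi).2⟩
    refine strictMonoOn_of_eventually_lt Set.ordConnected_Ioo (fun α hα => ?_) fun α hα => ?_ <;>
      obtain ⟨hmono, hmem, -, -⟩ := hx α hα.1 hα.2 <;>
      have ht := strictMonoOn_withEndpoints hM hmono hmem
    · filter_upwards [(hsigns α hα).1] with β hβ hβ01
      obtain ⟨hmono', -, ⟨c, hc, hfac⟩, -⟩ := hx β hβ01.1 hβ01.2
      have h := mem_Ioo_of_scaledKrawtchouk_alternating hmono' hc hfac
        (t := fun i => withEndpoints n M (x α) (i + 1))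
        (fun a ha b hb hab => ht (Nat.succ_le_succ ha) (Nat.succ_le_succ hb)
          (Nat.succ_lt_succ hab))
        (fun i hi => by
          rcases hi.lt_or_eq with hin | rfl
          · rw [withEndpoints_succ_of_lt _ _ hin]
            exact hβ i hin
          · rw [withEndpoints_succ_self, scaledKrawtchouk_natCast_right hnN, ← mul_pow]
            exact pow_pos (by linarith [hβ01.2]) _) j.2
      have h' := h.1
      rwa [withEndpoints_succ_of_lt _ _ j.2] at h'
    · filter_upwards [(hsigns α hα).2] with β hβ hβ01
      obtain ⟨hmono', -, ⟨c, hc, hfac⟩, -⟩ := hx β hβ01.1 hβ01.2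
      have h := mem_Ioo_of_scaledKrawtchouk_alternating hmono' hc hfac
        (ht.mono (Set.Iic_subset_Iic.2 n.le_succ))
        (fun i hi => by
          rcases i with _ | i
          · simpa [withEndpoints, scaledKrawtchouk_zero_right] using pow_pos hβ01.1 n
          · rw [withEndpoints_succ_of_lt _ _ hi, pow_succ]
            linarith [hβ i hi]) j.2
      have h' := h.2
      rwa [withEndpoints_succ_of_lt _ _ j.2] at h'
end

section
/- Fix a real number a > -1/2, integers N ≥ 2 and 1 ≤ n ≤ N-1, and parameters α > -1, -1 < β < 2a+1. The Racah polynomial R_n^{(α,β)} has n distinct real zeros X_1(α,β) < ⋯ < X_n(α,β) in (a(a+1), (a+N-1)(a+N)). If a ≥ 0, then for each j ∈ {1,...,n} the zero X_j(α,β) is a strictly decreasing function of α on (-1, ∞) and a strictly increasing function of β on (-1, 2a+1). If -1/2 < a < 0, then for each fixed β ∈ (a, 2a+1) each zero X_j(α,β) is a strictly decreasing function of α on (-1, ∞), and each zero X_j(α,β) is a strictly increasing function of β on (a, 2a+1). -/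
/-- Racah polynomial `R_n^{(α,β)}(X)` in the variable `X` of the quadratic grid
`X = s(s+1)`. -/
noncomputable def racahPoly (a : ℝ) (N n : ℕ) (α β X : ℝ) : ℝ :=
  ∑ k ∈ Finset.range (n + 1),
    poch (-(n : ℝ)) k * poch ((n : ℝ) + α + β + 1) k *
      (∏ j ∈ Finset.range k, ((a + (j : ℝ)) * (a + (j : ℝ) + 1) - X)) /
      (poch (2 * a + α + (N : ℝ) + 1) k * poch (β + 1) k * poch (1 - (N : ℝ)) k *
        (Nat.factorial k : ℝ))

open Polynomial in
/-- A nonzero polynomial of degree less than `N - 1` is nonzero at some of the first `N` nodes,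
even when one node is excluded. -/
theorem exists_eval_node_ne_zero {x : ℕ → ℝ} (hx : StrictMono x) {N : ℕ} {f : ℝ[X]}
    (hf : f ≠ 0) (hdeg : f.natDegree + 1 < N) (i₀ : ℕ) :
    ∃ i < N, i ≠ i₀ ∧ f.eval (x i) ≠ 0 := by
  by_contra! h
  refine hf (eq_zero_of_natDegree_lt_card_of_eval_eq_zero' f
    (((Finset.range N).erase i₀).image x) ?_ ?_)
  · intro y hy
    obtain ⟨i, hi, rfl⟩ := Finset.mem_image.1 hy
    rw [Finset.mem_erase, Finset.mem_range] at hi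
    exact h i hi.2 hi.1
  · rw [Finset.card_image_of_injective _ hx.injective]
    have := Finset.pred_card_le_card_erase (s := Finset.range N) (a := i₀)
    rw [Finset.card_range] at this
    omega

open Polynomial in
theorem sum_mul_eval_sq_pos {x : ℕ → ℝ} (hx : StrictMono x) {N : ℕ} {f : ℝ[X]}
    (hf : f ≠ 0) (hdeg : f.natDegree + 1 < N) {c : ℕ → ℝ} (i₀ : ℕ)
    (hc₀ : ∀ i < N, 0 ≤ c i) (hc : ∀ i < N, i ≠ i₀ → 0 < c i) :
    0 < ∑ i ∈ Finset.range N, c i * f.eval (x i) ^ 2 := by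
  obtain ⟨i, hi, hne, hev⟩ := exists_eval_node_ne_zero hx hf hdeg i₀
  refine Finset.sum_pos' (fun k hk => ?_) ⟨i, Finset.mem_range.2 hi, ?_⟩
  · exact mul_nonneg (hc₀ k (Finset.mem_range.1 hk)) (sq_nonneg _)
  · exact mul_pos (hc i hi hne) (by positivity)

open Polynomial in
/-- `p` is orthogonal to all polynomials of degree less than `n` with respect to the discrete
measure `∑ i < N, w i δ_{x i}`. -/
def DiscreteOrthogonal (x w : ℕ → ℝ) (N n : ℕ) (p : ℝ[X]) : Prop :=
  ∀ q : ℝ[X], q.degree < n → ∑ i ∈ Finset.range N, w i * (p.eval (x i) * q.eval (x i)) = 0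

open Polynomial in
/-- A polynomial orthogonal to lower degrees has no nontrivial factor that keeps a sign on all
nodes and vanishes on at most one of them. -/
theorem DiscreteOrthogonal.not_mul_eq {x w : ℕ → ℝ} {N n : ℕ} {p : ℝ[X]}
    (hp : DiscreteOrthogonal x w N n p) (hx : StrictMono x) (hw : ∀ i < N, 0 < w i)
    (hnN : n < N) {m h : ℝ[X]} (hh : h ≠ 0) (hdeg : h.natDegree < n) (i₀ : ℕ)
    (hm₀ : ∀ i < N, 0 ≤ m.eval (x i)) (hm : ∀ i < N, i ≠ i₀ → 0 < m.eval (x i)) :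
    p ≠ m * h := by
  rintro rfl
  have h1 := hp h ((natDegree_lt_iff_degree_lt hh).1 hdeg)
  have h2 := sum_mul_eval_sq_pos hx (N := N) hh (by omega) (c := fun i => w i * m.eval (x i)) i₀
    (fun i hi => mul_nonneg (hw i hi).le (hm₀ i hi))
    (fun i hi hne => mul_pos (hw i hi) (hm i hi hne))
  refine h2.ne' (h1 ▸ Finset.sum_congr rfl fun i _ => ?_)
  rw [eval_mul]
  ring

open Polynomial in
theorem DiscreteOrthogonal.splits {x w : ℕ → ℝ} {N n : ℕ} {p : ℝ[X]}
    (hp : DiscreteOrthogonal x w N n p) (hx : StrictMono x) (hw : ∀ i < N, 0 < w i)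
    (hnN : n < N) (hpn : p.natDegree = n) (hp0 : p ≠ 0) : p.Splits := by
  refine Splits.of_splits_map (algebraMap ℝ ℂ) (IsAlgClosed.splits _) fun z hz => ?_
  have hz0 : aeval z p = 0 := by
    rw [mem_roots_map_of_injective (algebraMap ℝ ℂ).injective hp0] at hz
    simpa [aeval_def] using hz
  by_cases him : z.im = 0
  · exact ⟨z.re, Complex.ext (by simp) (by simp [him])⟩
  exfalso
  obtain ⟨h, hph⟩ := p.quadratic_dvd_of_aeval_eq_zero_im_ne_zero hz0 him
  have hh : h ≠ 0 := by rintro rfl; simp at hph; exact hp0 hph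
  have hq2 : (X ^ 2 - C (2 * z.re) * X + C (‖z‖ ^ 2) : ℝ[X]).natDegree = 2 := by
    compute_degree!
  have hq0 : (X ^ 2 - C (2 * z.re) * X + C (‖z‖ ^ 2) : ℝ[X]) ≠ 0 := by
    intro h0; rw [h0] at hq2; simp at hq2
  have hd := congrArg natDegree hph
  rw [natDegree_mul hq0 hh, hq2, hpn] at hd
  have hpos : ∀ t : ℝ, 0 < (X ^ 2 - C (2 * z.re) * X + C (‖z‖ ^ 2) : ℝ[X]).eval t := by
    intro t
    simp only [eval_add, eval_sub, eval_mul, eval_pow, eval_X, eval_C]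
    rw [Complex.sq_norm, Complex.normSq_apply]
    have : 0 < z.im ^ 2 := by positivity
    nlinarith [sq_nonneg (t - z.re)]
  exact hp.not_mul_eq hx hw hnN hh (by omega) 0 (fun i _ => (hpos _).le)
    (fun i _ _ => hpos _) hph

open Polynomial in
theorem DiscreteOrthogonal.nodup_roots {x w : ℕ → ℝ} {N n : ℕ} {p : ℝ[X]}
    (hp : DiscreteOrthogonal x w N n p) (hx : StrictMono x) (hw : ∀ i < N, 0 < w i)
    (hnN : n < N) (hpn : p.natDegree = n) (hp0 : p ≠ 0) : p.roots.Nodup := by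
  rw [Multiset.nodup_iff_count_le_one]
  intro z
  by_contra! hz
  rw [count_roots] at hz
  obtain ⟨h, hph⟩ := (le_rootMultiplicity_iff hp0).1 hz
  change p = (X - C z) ^ 2 * h at hph
  have hh : h ≠ 0 := by rintro rfl; simp at hph; exact hp0 hph
  have hd := congrArg natDegree hph
  rw [natDegree_mul (pow_ne_zero _ (X_sub_C_ne_zero z)) hh, natDegree_pow, natDegree_X_sub_C,
    hpn] at hd
  have hev : ∀ t : ℝ, ((X - C z) ^ 2).eval t = (t - z) ^ 2 := by simp
  obtain ⟨i₀, hi₀⟩ : ∃ i₀, ∀ i, i ≠ i₀ → x i ≠ z := by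
    by_cases hex : ∃ i, x i = z
    · obtain ⟨i, rfl⟩ := hex
      exact ⟨i, fun k hk => hx.injective.ne hk⟩
    · push Not at hex
      exact ⟨0, fun i _ => hex i⟩
  refine hp.not_mul_eq hx hw hnN hh (by omega) i₀ (fun i _ => ?_) (fun i _ hne => ?_) hph
  · rw [hev]; positivity
  · rw [hev]
    have := sub_ne_zero.2 (hi₀ i hne)
    positivity

open Polynomial in
theorem DiscreteOrthogonal.root_mem_Ioo {x w : ℕ → ℝ} {N n : ℕ} {p : ℝ[X]}
    (hp : DiscreteOrthogonal x w N n p) (hx : StrictMono x) (hw : ∀ i < N, 0 < w i)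
    (hnN : n < N) (hpn : p.natDegree = n) (hp0 : p ≠ 0) {z : ℝ} (hz : p.IsRoot z) :
    z ∈ Set.Ioo (x 0) (x (N - 1)) := by
  obtain ⟨h, hph⟩ := dvd_iff_isRoot.2 hz
  have hh : h ≠ 0 := by rintro rfl; simp at hph; exact hp0 hph
  have hd := congrArg natDegree hph
  rw [natDegree_mul (X_sub_C_ne_zero z) hh, natDegree_X_sub_C, hpn] at hd
  constructor
  · by_contra! hle
    refine hp.not_mul_eq hx hw hnN hh (by omega) 0 (fun i _ => ?_) (fun i _ hne => ?_) hph
    · simpa using hle.trans (hx.monotone (Nat.zero_le i))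
    · simpa using hle.trans_lt (hx (Nat.pos_of_ne_zero hne))
  · by_contra! hle
    refine hp.not_mul_eq hx hw hnN (m := C z - X) (h := -h) (neg_ne_zero.2 hh)
      (by rw [natDegree_neg]; omega) (N - 1) (fun i hi => ?_) (fun i hi hne => ?_)
      (by rw [hph]; ring)
    · simpa using (hx.monotone (show i ≤ N - 1 by omega)).trans hle
    · simpa using (hx (show i < N - 1 by omega)).trans_le hle

open Polynomial in
theorem DiscreteOrthogonal.exists_strictMono_roots {x w : ℕ → ℝ} {N n : ℕ} {p : ℝ[X]}
    (hp : DiscreteOrthogonal x w N n p) (hx : StrictMono x) (hw : ∀ i < N, 0 < w i)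
    (hnN : n < N) (hpn : p.natDegree = n) (hp0 : p ≠ 0) :
    ∃ Z : Fin n → ℝ, StrictMono Z ∧ (∀ j, Z j ∈ Set.Ioo (x 0) (x (N - 1))) ∧
      p = C p.leadingCoeff * Lagrange.nodal Finset.univ Z := by
  have hnd := hp.nodup_roots hx hw hnN hpn hp0
  have hs := hp.splits hx hw hnN hpn hp0
  have hcard : p.roots.toFinset.card = n := by
    rw [Multiset.toFinset_card_of_nodup hnd, ← hs.natDegree_eq_card_roots, hpn]
  refine ⟨p.roots.toFinset.orderEmbOfFin hcard, OrderEmbedding.strictMono _, fun j => ?_, ?_⟩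
  · have := p.roots.toFinset.orderEmbOfFin_mem hcard j
    rw [Multiset.mem_toFinset, mem_roots hp0] at this
    exact hp.root_mem_Ioo hx hw hnN hpn hp0 this
  · conv_lhs => rw [hs.eq_prod_roots]
    congr 1
    have h := Finset.prod_map Finset.univ
      (p.roots.toFinset.orderEmbOfFin hcard).toEmbedding (fun y => X - C y)
    rw [Finset.map_orderEmbOfFin_univ, Finset.prod, Multiset.toFinset_val, hnd.dedup] at h
    exact h

open Polynomial in
/-- Positivity of Gaussian quadrature. -/
theorem DiscreteOrthogonal.sum_nonneg {x w : ℕ → ℝ} {N n : ℕ} {Z : Fin n → ℝ}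
    (hZ : Function.Injective Z)
    (hp : DiscreteOrthogonal x w N n (Lagrange.nodal Finset.univ Z)) (hw : ∀ i < N, 0 < w i)
    {h : ℝ[X]} (hdeg : h.natDegree < 2 * n) (hh : ∀ j, 0 ≤ h.eval (Z j)) :
    0 ≤ ∑ i ∈ Finset.range N, w i * h.eval (x i) := by
  have hn : 0 < n := by omega
  set s := Lagrange.interpolate Finset.univ Z (fun j => √(h.eval (Z j))) with hs
  have hsd : s.degree < n := by
    have := Lagrange.degree_interpolate_lt (s := Finset.univ) (v := Z)
      (fun j => √(h.eval (Z j))) hZ.injOn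
    rwa [Finset.card_univ, Fintype.card_fin] at this
  have hsZ : ∀ j, s.eval (Z j) ^ 2 = h.eval (Z j) := by
    intro j
    rw [hs, Lagrange.eval_interpolate_at_node _ hZ.injOn (Finset.mem_univ j),
      Real.sq_sqrt (hh j)]
  have hsn : s.natDegree < n := by
    by_cases h0 : s = 0
    · simpa [h0] using hn
    · exact (natDegree_lt_iff_degree_lt h0).2 hsd
  have hmon : (Lagrange.nodal Finset.univ Z).Monic := Lagrange.nodal_monic
  have hnd : (Lagrange.nodal Finset.univ Z).natDegree = n := by simp [Lagrange.natDegree_nodal]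
  have hmod : (h - s ^ 2) %ₘ Lagrange.nodal Finset.univ Z = 0 := by
    refine eq_zero_of_degree_lt_of_eval_index_eq_zero (s := Finset.univ) (v := Z)
      hZ.injOn ?_ fun j _ => ?_
    · have := degree_modByMonic_lt (h - s ^ 2) hmon
      rwa [Lagrange.degree_nodal] at this
    · have h1 := congrArg (eval (Z j)) (modByMonic_add_div (h - s ^ 2) (Lagrange.nodal Finset.univ Z))
      rw [eval_add, eval_mul, Lagrange.eval_nodal_at_node (Finset.mem_univ j), zero_mul, add_zero,
        eval_sub, eval_pow, hsZ, sub_self] at h1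
      exact h1
  have hdiv := modByMonic_add_div (h - s ^ 2) (Lagrange.nodal Finset.univ Z)
  rw [hmod, zero_add] at hdiv
  set g := (h - s ^ 2) /ₘ Lagrange.nodal Finset.univ Z with hg
  have hgd : g.degree < n := by
    by_cases h0 : g = 0
    · rw [h0, degree_zero]; exact WithBot.bot_lt_coe n
    rw [← natDegree_lt_iff_degree_lt h0, hg, natDegree_divByMonic _ hmon, hnd]
    have : (h - s ^ 2).natDegree ≤ max h.natDegree (s ^ 2).natDegree := natDegree_sub_le _ _
    rw [natDegree_pow] at this
    omega
  have h0 := hp g hgd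
  have heq : ∑ i ∈ Finset.range N, w i * h.eval (x i) =
      ∑ i ∈ Finset.range N, w i * s.eval (x i) ^ 2 := by
    rw [← sub_eq_zero, ← Finset.sum_sub_distrib, ← h0]
    refine Finset.sum_congr rfl fun i _ => ?_
    rw [← eval_mul, hdiv, eval_sub, eval_pow]
    ring
  rw [heq]
  exact Finset.sum_nonneg fun i hi => mul_nonneg (hw i (Finset.mem_range.1 hi)).le (sq_nonneg _)

open Polynomial in
/-- **Markov's theorem** for discrete measures on a common set of nodes: if the ratio of the
weights is strictly increasing, then the zeros of the orthogonal polynomials move to the right. -/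
theorem DiscreteOrthogonal.root_lt_root {x w w' : ℕ → ℝ} {N n : ℕ} {Y Z : Fin n → ℝ}
    (hx : StrictMono x) (hnN : n < N) (hw : ∀ i < N, 0 < w i) (hw' : ∀ i < N, 0 < w' i)
    (hr : ∀ i k, i < k → k < N → w' i / w i < w' k / w k)
    (hY : StrictMono Y) (hZ : StrictMono Z) (hYx : ∀ j, x 0 ≤ Y j)
    (hYo : DiscreteOrthogonal x w N n (Lagrange.nodal Finset.univ Y))
    (hZo : DiscreteOrthogonal x w' N n (Lagrange.nodal Finset.univ Z)) (j : Fin n) :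
    Y j < Z j := by
  set f : ℝ[X] := Lagrange.nodal (Finset.Iio j) Y * Lagrange.nodal (Finset.Ioi j) Z with hf
  have hf0 : f ≠ 0 := mul_ne_zero Lagrange.nodal_ne_zero Lagrange.nodal_ne_zero
  have hfd : f.natDegree + 1 = n := by
    rw [hf, natDegree_mul Lagrange.nodal_ne_zero Lagrange.nodal_ne_zero,
      Lagrange.natDegree_nodal, Lagrange.natDegree_nodal, Fin.card_Iio, Fin.card_Ioi]
    omega
  have hdeg : ∀ t : ℝ, ((X - C t) * f ^ 2).natDegree < 2 * n := by
    intro t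
    rw [natDegree_mul (X_sub_C_ne_zero t) (pow_ne_zero _ hf0), natDegree_X_sub_C, natDegree_pow]
    omega
  have hev : ∀ t y : ℝ, ((X - C t) * f ^ 2).eval y = (y - t) * f.eval y ^ 2 := by simp
  have h1 : 0 ≤ ∑ i ∈ Finset.range N, w i * ((x i - Y j) * f.eval (x i) ^ 2) := by
    have := hYo.sum_nonneg hY.injective hw (hdeg (Y j)) fun k => by
      rw [hev]
      rcases lt_or_ge k j with hk | hk
      · rw [hf, eval_mul, Lagrange.eval_nodal_at_node (Finset.mem_Iio.2 hk)]
        simp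
      · exact mul_nonneg (sub_nonneg.2 (hY.monotone hk)) (sq_nonneg _)
    simpa only [hev] using this
  have h2 : ∑ i ∈ Finset.range N, w' i * ((x i - Z j) * f.eval (x i) ^ 2) ≤ 0 := by
    have := hZo.sum_nonneg hZ.injective hw' (h := -((X - C (Z j)) * f ^ 2))
      (by rw [natDegree_neg]; exact hdeg _) fun k => by
      rw [eval_neg, hev]
      rcases lt_or_ge j k with hk | hk
      · rw [hf, eval_mul, Lagrange.eval_nodal_at_node (Finset.mem_Ioi.2 hk)]
        simp
      · rw [neg_nonneg]
        exact mul_nonpos_of_nonpos_of_nonneg (sub_nonpos.2 (hZ.monotone hk)) (sq_nonneg _)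
    simpa only [eval_neg, hev, mul_neg, Finset.sum_neg_distrib, neg_nonneg] using this
  obtain ⟨i₀, hi₀N, hle, hgt⟩ : ∃ i₀ < N, x i₀ ≤ Y j ∧ ∀ i < N, i₀ < i → Y j < x i := by
    set S := (Finset.range N).filter fun i => x i ≤ Y j with hS
    have hne : S.Nonempty := ⟨0, by simp [hS, hYx j]; omega⟩
    have hmem := S.max'_mem hne
    simp only [hS, Finset.mem_filter, Finset.mem_range] at hmem
    refine ⟨S.max' hne, hmem.1, hmem.2, fun i hi hlt => ?_⟩
    by_contra! hc
    exact (S.le_max' i (by simp [hS, hi, hc])).not_gt hlt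
  have h3 := sum_mul_eval_sq_pos hx (N := N) hf0 (by omega)
    (c := fun i => w i * ((x i - Y j) * (w' i / w i - w' i₀ / w i₀))) i₀ (fun i hi => ?_)
    (fun i hi hne => ?_)
  rotate_left
  · rcases lt_trichotomy i i₀ with h | h | h
    · exact mul_nonneg (hw i hi).le (mul_nonneg_of_nonpos_of_nonpos
        (sub_nonpos.2 ((hx h).le.trans hle)) (sub_nonpos.2 (hr i i₀ h hi₀N).le))
    · subst h; simp
    · exact mul_nonneg (hw i hi).le (mul_nonneg
        (sub_nonneg.2 (hgt i hi h).le) (sub_nonneg.2 (hr i₀ i h hi).le))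
  · rcases lt_or_gt_of_ne hne with h | h
    · exact mul_pos (hw i hi) (mul_pos_of_neg_of_neg
        (sub_neg.2 ((hx h).trans_le hle)) (sub_neg.2 (hr i i₀ h hi₀N)))
    · exact mul_pos (hw i hi) (mul_pos (sub_pos.2 (hgt i hi h)) (sub_pos.2 (hr i₀ i h hi)))
  have h4 := sum_mul_eval_sq_pos hx (N := N) hf0 (by omega) 0 (fun i hi => (hw' i hi).le)
    (fun i hi _ => hw' i hi)
  have h5 : ∑ i ∈ Finset.range N, w i * ((x i - Y j) * (w' i / w i - w' i₀ / w i₀)) *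
        f.eval (x i) ^ 2 =
      ∑ i ∈ Finset.range N, w' i * ((x i - Z j) * f.eval (x i) ^ 2) +
      (Z j - Y j) * ∑ i ∈ Finset.range N, w' i * f.eval (x i) ^ 2 -
      w' i₀ / w i₀ * ∑ i ∈ Finset.range N, w i * ((x i - Y j) * f.eval (x i) ^ 2) := by
    rw [Finset.mul_sum, Finset.mul_sum, ← Finset.sum_add_distrib, ← Finset.sum_sub_distrib]
    refine Finset.sum_congr rfl fun i hi => ?_
    have := (hw i (Finset.mem_range.1 hi)).ne'
    field_simp
    ring
  rw [h5] at h3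
  have h6 : 0 ≤ w' i₀ / w i₀ * ∑ i ∈ Finset.range N, w i * ((x i - Y j) * f.eval (x i) ^ 2) :=
    mul_nonneg (div_pos (hw' _ hi₀N) (hw _ hi₀N)).le h1
  have h7 : 0 < (Z j - Y j) * ∑ i ∈ Finset.range N, w' i * f.eval (x i) ^ 2 := by linarith
  exact sub_pos.1 (pos_of_mul_pos_left h7 h4.le)

/-- Nodes of the quadratic grid. -/
noncomputable def racahNode (a : ℝ) (i : ℕ) : ℝ := (a + (i : ℝ)) * (a + (i : ℝ) + 1)

theorem racahNode_strictMono {a : ℝ} (ha : -1 / 2 < a) : StrictMono (racahNode a) := by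
  refine strictMono_nat_of_lt_succ fun i => ?_
  have : (0 : ℝ) ≤ i := i.cast_nonneg
  simp only [racahNode, Nat.cast_add, Nat.cast_one]
  nlinarith

open Polynomial in
/-- The basis polynomials `∏_{j < k} (x_j - X)` in which Racah polynomials are expanded. -/
noncomputable def racahBasis (a : ℝ) (k : ℕ) : ℝ[X] :=
  ∏ j ∈ Finset.range k, (C (racahNode a j) - X)

open Polynomial in
theorem racahBasis_succ (a : ℝ) (k : ℕ) :
    racahBasis a (k + 1) = racahBasis a k * (C (racahNode a k) - X) :=
  Finset.prod_range_succ _ _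

open Polynomial in
theorem eval_racahBasis_succ (a : ℝ) (k : ℕ) (y : ℝ) :
    (racahBasis a (k + 1)).eval y = (racahBasis a k).eval y * (racahNode a k - y) := by
  simp [racahBasis_succ]

open Polynomial in
theorem natDegree_racahBasis (a : ℝ) (k : ℕ) : (racahBasis a k).natDegree = k := by
  have hne (j : ℕ) : (C (racahNode a j) - X : ℝ[X]) ≠ 0 := by
    rw [← neg_sub]; exact neg_ne_zero.2 (X_sub_C_ne_zero _)
  rw [racahBasis, natDegree_prod _ _ fun j _ => hne j]
  have hd (j : ℕ) : (C (racahNode a j) - X : ℝ[X]).natDegree = 1 := by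
    rw [← neg_sub, natDegree_neg, natDegree_X_sub_C]
  simp [hd]

open Polynomial in
theorem coeff_racahBasis_self_ne_zero (a : ℝ) (k : ℕ) : (racahBasis a k).coeff k ≠ 0 := by
  have hne : racahBasis a k ≠ 0 := Finset.prod_ne_zero_iff.2 fun j _ => by
    rw [← neg_sub]; exact neg_ne_zero.2 (X_sub_C_ne_zero _)
  have := leadingCoeff_ne_zero.2 hne
  rwa [leadingCoeff, natDegree_racahBasis] at this

open Polynomial in
theorem DiscreteOrthogonal.of_racahBasis {x w : ℕ → ℝ} {N n : ℕ} {p : ℝ[X]} (a : ℝ)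
    (h : ∀ k < n, ∑ i ∈ Finset.range N, w i * (p.eval (x i) * (racahBasis a k).eval (x i)) = 0) :
    DiscreteOrthogonal x w N n p := by
  suffices H : ∀ m ≤ n, ∀ q : ℝ[X], q.degree < m →
      ∑ i ∈ Finset.range N, w i * (p.eval (x i) * q.eval (x i)) = 0 from H n le_rfl
  intro m
  induction m with
  | zero =>
    intro _ q hq
    have : q = 0 := by
      ext k
      simpa using (degree_lt_iff_coeff_zero q 0).1 hq k (Nat.zero_le k)
    simp [this]
  | succ m ih =>
    intro hm q hq
    set c := q.coeff m / (racahBasis a m).coeff m with hc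
    have hdeg : (q - C c * racahBasis a m).degree < m := by
      rw [degree_lt_iff_coeff_zero]
      intro k hk
      rw [coeff_sub, coeff_C_mul]
      rcases hk.eq_or_lt with rfl | hlt
      · rw [hc, div_mul_cancel₀ _ (coeff_racahBasis_self_ne_zero a m), sub_self]
      · rw [(degree_lt_iff_coeff_zero q (m + 1)).1 hq k hlt,
          coeff_eq_zero_of_natDegree_lt (by rwa [natDegree_racahBasis])]
        simp
    have h1 := ih (by omega) _ hdeg
    have h2 := h m hm
    have h3 : ∑ i ∈ Finset.range N, w i * (p.eval (x i) * q.eval (x i)) =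
        ∑ i ∈ Finset.range N, w i * (p.eval (x i) * (q - C c * racahBasis a m).eval (x i)) +
        c * ∑ i ∈ Finset.range N, w i * (p.eval (x i) * (racahBasis a m).eval (x i)) := by
      rw [Finset.mul_sum, ← Finset.sum_add_distrib]
      refine Finset.sum_congr rfl fun i _ => ?_
      rw [eval_sub, eval_mul, eval_C]
      ring
    rw [h3, h1, h2]
    ring

/-- Ratio of consecutive Racah weights, up to the factors `2 s + 1`. -/
noncomputable def racahRatio (a : ℝ) (N : ℕ) (α β : ℝ) (i : ℕ) : ℝ :=
  ((2 * a + 1 + i) * (β + 1 + i) * (2 * a + N + α + 1 + i) * (N - 1 - i)) /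
    ((α + N - 1 - i) * (2 * a + 1 - β + i) * (i + 1) * (2 * a + N + 1 + i))

/-- Racah weight on the quadratic grid, normalised up to a constant. -/
noncomputable def racahWeight (a : ℝ) (N : ℕ) (α β : ℝ) (i : ℕ) : ℝ :=
  (2 * a + 2 * i + 1) * ∏ j ∈ Finset.range i, racahRatio a N α β j

theorem racahRatio_pos {a α β : ℝ} {N i : ℕ} (ha : -1 / 2 < a) (hα : -1 < α) (hβ : -1 < β)
    (hβ' : β < 2 * a + 1) (hi : i + 1 < N) : 0 < racahRatio a N α β i := by
  have h0 : (0 : ℝ) ≤ i := i.cast_nonneg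
  have h1 : (i : ℝ) + 1 + 1 ≤ N := by exact_mod_cast hi
  have e1 : 0 < 2 * a + 1 + i := by linarith
  have e2 : 0 < β + 1 + i := by linarith
  have e3 : 0 < 2 * a + N + α + 1 + i := by linarith
  have e4 : (0 : ℝ) < N - 1 - i := by linarith
  have e5 : 0 < α + N - 1 - i := by linarith
  have e6 : 0 < 2 * a + 1 - β + i := by linarith
  have e7 : 0 < 2 * a + N + 1 + i := by linarith
  unfold racahRatio
  positivity

theorem racahWeight_pos {a α β : ℝ} {N i : ℕ} (ha : -1 / 2 < a) (hα : -1 < α) (hβ : -1 < β)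
    (hβ' : β < 2 * a + 1) (hi : i < N) : 0 < racahWeight a N α β i := by
  have h0 : (0 : ℝ) ≤ i := i.cast_nonneg
  refine mul_pos (by linarith) (Finset.prod_pos fun j hj => ?_)
  rw [Finset.mem_range] at hj
  exact racahRatio_pos ha hα hβ hβ' (by omega)

theorem racahRatio_lt_of_alpha_lt {a α α' β : ℝ} {N i : ℕ} (ha : -1 / 2 < a) (hα : -1 < α)
    (hα' : α < α') (hβ : -1 < β) (hβ' : β < 2 * a + 1) (hi : i + 1 < N) :
    racahRatio a N α' β i < racahRatio a N α β i := by
  have h0 : (0 : ℝ) ≤ i := i.cast_nonneg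
  have h1 : (i : ℝ) + 1 + 1 ≤ N := by exact_mod_cast hi
  have e1 : 0 < 2 * a + 1 + i := by linarith
  have e2 : 0 < β + 1 + i := by linarith
  have e4 : (0 : ℝ) < N - 1 - i := by linarith
  have e5 : 0 < α + N - 1 - i := by linarith
  have e5' : 0 < α' + N - 1 - i := by linarith
  have e6 : 0 < 2 * a + 1 - β + i := by linarith
  have e7 : 0 < 2 * a + N + 1 + i := by linarith
  have key : (2 * a + N + α' + 1 + i) / (α' + N - 1 - i) <
      (2 * a + N + α + 1 + i) / (α + N - 1 - i) := by
    rw [div_lt_div_iff₀ e5' e5]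
    nlinarith
  have hpos : 0 < (2 * a + 1 + i) * (β + 1 + i) * (N - 1 - i) /
      ((2 * a + 1 - β + i) * (i + 1) * (2 * a + N + 1 + i)) := by positivity
  have heq (γ : ℝ) : racahRatio a N γ β i = (2 * a + 1 + i) * (β + 1 + i) * (N - 1 - i) /
      ((2 * a + 1 - β + i) * (i + 1) * (2 * a + N + 1 + i)) *
      ((2 * a + N + γ + 1 + i) / (γ + N - 1 - i)) := by
    rw [racahRatio, div_mul_div_comm]
    congr 1 <;> ring
  rw [heq, heq]
  exact mul_lt_mul_of_pos_left key hpos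

theorem racahRatio_lt_of_beta_lt {a α β β' : ℝ} {N i : ℕ} (ha : -1 / 2 < a) (hα : -1 < α)
    (hβ : -1 < β) (hlt : β < β') (hβ' : β' < 2 * a + 1) (hi : i + 1 < N) :
    racahRatio a N α β i < racahRatio a N α β' i := by
  have h0 : (0 : ℝ) ≤ i := i.cast_nonneg
  have h1 : (i : ℝ) + 1 + 1 ≤ N := by exact_mod_cast hi
  have e1 : 0 < 2 * a + 1 + i := by linarith
  have e3 : 0 < 2 * a + N + α + 1 + i := by linarith
  have e4 : (0 : ℝ) < N - 1 - i := by linarith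
  have e5 : 0 < α + N - 1 - i := by linarith
  have e6 : 0 < 2 * a + 1 - β + i := by linarith
  have e6' : 0 < 2 * a + 1 - β' + i := by linarith
  have e7 : 0 < 2 * a + N + 1 + i := by linarith
  have key : (β + 1 + i) / (2 * a + 1 - β + i) < (β' + 1 + i) / (2 * a + 1 - β' + i) := by
    rw [div_lt_div_iff₀ e6 e6']
    nlinarith
  have hpos : 0 < (2 * a + 1 + i) * (2 * a + N + α + 1 + i) * (N - 1 - i) /
      ((α + N - 1 - i) * (i + 1) * (2 * a + N + 1 + i)) := by positivity
  have heq (γ : ℝ) : racahRatio a N α γ i =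
      (2 * a + 1 + i) * (2 * a + N + α + 1 + i) * (N - 1 - i) /
      ((α + N - 1 - i) * (i + 1) * (2 * a + N + 1 + i)) *
      ((γ + 1 + i) / (2 * a + 1 - γ + i)) := by
    rw [racahRatio, div_mul_div_comm]
    congr 1 <;> ring
  rw [heq, heq]
  exact mul_lt_mul_of_pos_left key hpos

theorem prod_div_prod_lt_of_lt {t t' : ℕ → ℝ} {i k : ℕ} (hik : i < k)
    (ht : ∀ j < k, 0 < t j) (hlt : ∀ j < k, t j < t' j) :
    (∏ j ∈ Finset.range i, t' j) / (∏ j ∈ Finset.range i, t j) <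
      (∏ j ∈ Finset.range k, t' j) / (∏ j ∈ Finset.range k, t j) := by
  rw [← Finset.prod_div_distrib, ← Finset.prod_div_distrib,
    ← Finset.prod_range_mul_prod_Ico _ hik.le]
  refine lt_mul_of_one_lt_right (Finset.prod_pos fun j hj => ?_) ?_
  · have hj' := (Finset.mem_range.1 hj).trans hik
    exact div_pos ((ht j hj').trans (hlt j hj')) (ht j hj')
  · rw [← Finset.prod_const_one (s := Finset.Ico i k)]
    refine Finset.prod_lt_prod (fun _ _ => one_pos) (fun j hj => ?_)
      ⟨i, Finset.left_mem_Ico.2 hik, ?_⟩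
    · exact (one_le_div (ht j (Finset.mem_Ico.1 hj).2)).2 (hlt j (Finset.mem_Ico.1 hj).2).le
    · exact (one_lt_div (ht i hik)).2 (hlt i hik)

theorem racahWeight_div_lt {a α β α' β' : ℝ} {N : ℕ} (ha : -1 / 2 < a)
    (ht : ∀ i, i + 1 < N → 0 < racahRatio a N α β i)
    (hlt : ∀ i, i + 1 < N → racahRatio a N α β i < racahRatio a N α' β' i)
    (i k : ℕ) (hik : i < k) (hk : k < N) :
    racahWeight a N α' β' i / racahWeight a N α β i <
      racahWeight a N α' β' k / racahWeight a N α β k := by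
  have hne (m : ℕ) : 2 * a + 2 * m + 1 ≠ 0 := by
    have : (0 : ℝ) ≤ m := m.cast_nonneg
    linarith
  rw [racahWeight, racahWeight, racahWeight, racahWeight, mul_div_mul_left _ _ (hne i),
    mul_div_mul_left _ _ (hne k)]
  exact prod_div_prod_lt_of_lt hik (fun j hj => ht j (by omega)) fun j hj => hlt j (by omega)

/-- Coefficient of the forward difference in the Racah difference operator. -/
noncomputable def racahUp (a : ℝ) (N : ℕ) (α β : ℝ) (i : ℕ) : ℝ :=
  ((2 * a + 1 + i) * (β + 1 + i) * (2 * a + N + α + 1 + i) * (N - 1 - i)) /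
    ((2 * a + 2 * i + 1) * (2 * a + 2 * i + 2))

/-- Coefficient of the backward difference in the Racah difference operator. -/
noncomputable def racahDown (a : ℝ) (N : ℕ) (α β : ℝ) (i : ℕ) : ℝ :=
  (i * (2 * a - β + i) * (2 * a + N + i) * (α + N - i)) /
    ((2 * a + 2 * i + 1) * (2 * a + 2 * i))

/-- The Racah difference operator. -/
noncomputable def racahDiffOp (a : ℝ) (N : ℕ) (α β : ℝ) (f : ℕ → ℝ) (i : ℕ) : ℝ :=
  racahUp a N α β i * (f (i + 1) - f i) + racahDown a N α β i * (f (i - 1) - f i)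

theorem racahWeight_mul_up {a α β : ℝ} {N i : ℕ} (ha : -1 / 2 < a) (hα : -1 < α)
    (hβ' : β < 2 * a + 1) (hi : i + 1 < N) :
    racahWeight a N α β i * racahUp a N α β i =
      racahWeight a N α β (i + 1) * racahDown a N α β (i + 1) := by
  have h0 : (0 : ℝ) ≤ i := i.cast_nonneg
  have h1 : (i : ℝ) + 1 + 1 ≤ N := by exact_mod_cast hi
  have e5 : α + N - 1 - i ≠ 0 := by linarith
  have e6 : 2 * a + 1 - β + i ≠ 0 := by linarith
  have e7 : 2 * a + N + 1 + i ≠ 0 := by linarith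
  have e8 : 2 * (a + i) + 1 ≠ 0 := by linarith
  have e9 : a + i + 1 ≠ 0 := by linarith
  have e10 : 2 * (a + i + 1) + 1 ≠ 0 := by linarith
  have e12 : (i : ℝ) + 1 ≠ 0 := by linarith
  simp only [racahWeight, racahUp, racahDown, Finset.prod_range_succ, racahRatio, Nat.cast_add,
    Nat.cast_one]
  set P := ∏ j ∈ Finset.range i, ((2 * a + 1 + (j : ℝ)) * (β + 1 + j) * (2 * a + N + α + 1 + j) *
    (N - 1 - j)) / ((α + N - 1 - j) * (2 * a + 1 - β + j) * (j + 1) * (2 * a + N + 1 + j))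
  rw [show 2 * a + 2 * ((i : ℝ) + 1) = 2 * a + 2 * i + 2 by ring,
    show 2 * a - β + ((i : ℝ) + 1) = 2 * a + 1 - β + i by ring,
    show 2 * a + N + ((i : ℝ) + 1) = 2 * a + N + 1 + i by ring,
    show α + N - ((i : ℝ) + 1) = α + N - 1 - i by ring]
  field_simp

theorem sum_racahDiffOp_mul {a α β : ℝ} {N : ℕ} (ha : -1 / 2 < a) (hα : -1 < α)
    (hβ' : β < 2 * a + 1) (f g : ℕ → ℝ) :
    ∑ i ∈ Finset.range N, racahWeight a N α β i * (racahDiffOp a N α β f i * g i) =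
      - ∑ i ∈ Finset.range (N - 1), racahWeight a N α β i * racahUp a N α β i *
        ((f (i + 1) - f i) * (g (i + 1) - g i)) := by
  rcases N with _ | M
  · simp
  have h1 : racahUp a (M + 1) α β M = 0 := by simp [racahUp]
  have h2 : racahDown a (M + 1) α β 0 = 0 := by simp [racahDown]
  have h3 (i : ℕ) : racahWeight a (M + 1) α β i * (racahDiffOp a (M + 1) α β f i * g i) =
      racahWeight a (M + 1) α β i * racahUp a (M + 1) α β i * ((f (i + 1) - f i) * g i) +
      racahWeight a (M + 1) α β i * racahDown a (M + 1) α β i * ((f (i - 1) - f i) * g i) := by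
    rw [racahDiffOp]; ring
  simp only [h3]
  rw [Finset.sum_add_distrib, Finset.sum_range_succ, h1, Finset.sum_range_succ', h2,
    ← Finset.sum_neg_distrib]
  simp only [mul_zero, zero_mul, add_zero, Nat.add_sub_cancel]
  rw [← Finset.sum_add_distrib]
  refine Finset.sum_congr rfl fun i hi => ?_
  rw [← racahWeight_mul_up ha hα hβ' (by have := Finset.mem_range.1 hi; omega)]
  ring

theorem sum_racahDiffOp_comm {a α β : ℝ} {N : ℕ} (ha : -1 / 2 < a) (hα : -1 < α)
    (hβ' : β < 2 * a + 1) (f g : ℕ → ℝ) :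
    ∑ i ∈ Finset.range N, racahWeight a N α β i * (racahDiffOp a N α β f i * g i) =
      ∑ i ∈ Finset.range N, racahWeight a N α β i * (f i * racahDiffOp a N α β g i) := by
  have h := sum_racahDiffOp_mul (N := N) ha hα hβ' g f
  simp only [mul_comm (racahDiffOp a N α β g _)] at h
  rw [h, sum_racahDiffOp_mul ha hα hβ']
  simp only [mul_comm (f (_ + 1) - f _)]

theorem racahBasis_forward_diff (a : ℝ) (k i : ℕ) :
    (2 * a + 1 + i) * ((racahBasis a (k + 1)).eval (racahNode a (i + 1)) -
      (racahBasis a (k + 1)).eval (racahNode a i)) =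
      -((k + 1) * (2 * a + 2 * i + 2) * (2 * a + 1 + i + k) *
        (racahBasis a k).eval (racahNode a i)) := by
  induction k with
  | zero =>
    simp only [eval_racahBasis_succ]
    simp [racahBasis, racahNode]
    ring
  | succ k ih =>
    have h1 : racahNode a (k + 1) - racahNode a (i + 1) = (k - i) * (2 * a + k + i + 3) := by
      simp only [racahNode, Nat.cast_add, Nat.cast_one]; ring
    have h2 : racahNode a (k + 1) - racahNode a i =
        (k - i) * (2 * a + k + i + 3) + (2 * a + 2 * i + 2) := by
      simp only [racahNode, Nat.cast_add, Nat.cast_one]; ring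
    have h3 : racahNode a k - racahNode a i = (k - i) * (2 * a + k + i + 1) := by
      simp only [racahNode]; ring
    rw [eval_racahBasis_succ a (k + 1), eval_racahBasis_succ a (k + 1), h1, h2]
    have h4 := eval_racahBasis_succ a k (racahNode a i)
    rw [h3] at h4
    push_cast
    rw [h4] at ih ⊢
    linear_combination ((k : ℝ) - i) * (2 * a + k + i + 3) * ih

theorem racahBasis_backward_diff (a : ℝ) (k i : ℕ) :
    (i + 1) * ((racahBasis a (k + 1)).eval (racahNode a i) -
      (racahBasis a (k + 1)).eval (racahNode a (i + 1))) =
      -((k - (i + 1)) * (k + 1) * (2 * a + 2 * (i + 1)) *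
        (racahBasis a k).eval (racahNode a (i + 1))) := by
  induction k with
  | zero =>
    simp only [eval_racahBasis_succ]
    simp [racahBasis, racahNode]
    ring
  | succ k ih =>
    have h1 : racahNode a (k + 1) - racahNode a i = (k + 1 - i) * (2 * a + k + i + 2) := by
      simp only [racahNode, Nat.cast_add, Nat.cast_one]; ring
    have h2 : racahNode a (k + 1) - racahNode a (i + 1) =
        (k + 1 - i) * (2 * a + k + i + 2) - (2 * a + 2 * i + 2) := by
      simp only [racahNode, Nat.cast_add, Nat.cast_one]; ring
    have h3 : racahNode a k - racahNode a (i + 1) = (k - (i + 1)) * (2 * a + k + i + 2) := by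
      simp only [racahNode, Nat.cast_add, Nat.cast_one]; ring
    rw [eval_racahBasis_succ a (k + 1), eval_racahBasis_succ a (k + 1), h1, h2]
    have h4 := eval_racahBasis_succ a k (racahNode a (i + 1))
    rw [h3] at h4
    push_cast
    rw [h4] at ih ⊢
    linear_combination ((k : ℝ) + 1 - i) * (2 * a + k + i + 2) * ih

theorem racahDiffOp_racahBasis {a : ℝ} (ha : -1 / 2 < a) (N : ℕ) (α β : ℝ) (k i : ℕ) :
    racahDiffOp a N α β (fun m => (racahBasis a k).eval (racahNode a m)) i =
      -(k * (k + α + β + 1) * (racahBasis a k).eval (racahNode a i)) -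
        k * ((β + k) * (2 * a + N + α + k) * (N - k)) *
          (racahBasis a (k - 1)).eval (racahNode a i) := by
  rcases k with _ | k
  · simp [racahDiffOp, racahBasis]
  have h0 : (0 : ℝ) ≤ i := i.cast_nonneg
  have e8 : 2 * a + 2 * i + 1 ≠ 0 := by linarith
  have e9 : 2 * a + 2 * i + 2 ≠ 0 := by linarith
  have hup : racahUp a N α β i * ((racahBasis a (k + 1)).eval (racahNode a (i + 1)) -
      (racahBasis a (k + 1)).eval (racahNode a i)) =
      -((k + 1) * (β + 1 + i) * (2 * a + N + α + 1 + i) * (N - 1 - i) * (2 * a + 1 + i + k)) *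
        (racahBasis a k).eval (racahNode a i) / (2 * a + 2 * i + 1) := by
    rw [racahUp, div_mul_eq_mul_div, div_eq_div_iff (mul_ne_zero e8 e9) e8]
    linear_combination (β + 1 + i) * (2 * a + N + α + 1 + i) * (N - 1 - i) *
      (2 * a + 2 * i + 1) * racahBasis_forward_diff a k i
  have hdown : racahDown a N α β i * ((racahBasis a (k + 1)).eval (racahNode a (i - 1)) -
      (racahBasis a (k + 1)).eval (racahNode a i)) =
      -((k + 1) * (k - i) * (2 * a - β + i) * (2 * a + N + i) * (α + N - i)) *
        (racahBasis a k).eval (racahNode a i) / (2 * a + 2 * i + 1) := by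
    rcases i with _ | i
    · rcases k with _ | k
      · simp [racahDown]
      · have : (racahBasis a (k + 1)).eval (racahNode a 0) = 0 := by
          rw [racahBasis, Polynomial.eval_prod]
          exact Finset.prod_eq_zero (Finset.mem_range.2 k.succ_pos) (by simp)
        simp [racahDown, this]
    · have h0' : (0 : ℝ) ≤ i := i.cast_nonneg
      have e10 : 2 * a + 2 * ((i : ℝ) + 1) ≠ 0 := by linarith
      have hb := racahBasis_backward_diff a k i
      simp only [racahDown, Nat.add_sub_cancel, Nat.cast_add, Nat.cast_one] at e8 ⊢
      rw [div_mul_eq_mul_div, div_eq_div_iff (mul_ne_zero e8 e10) e8]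
      linear_combination (2 * a - β + (i + 1)) * (2 * a + N + (i + 1)) * (α + N - (i + 1)) *
        (2 * a + 2 * (i + 1) + 1) * hb
  have h3 : racahNode a k - racahNode a i = (k - i) * (2 * a + k + i + 1) := by
    simp only [racahNode]; ring
  rw [racahDiffOp, hup, hdown, Nat.add_sub_cancel, eval_racahBasis_succ, h3, ← add_div,
    div_eq_iff e8]
  push_cast
  ring

/-- Coefficients of the Racah polynomial in the basis `racahBasis`. -/
noncomputable def racahCoeff (a : ℝ) (N n : ℕ) (α β : ℝ) (k : ℕ) : ℝ :=
  poch (-(n : ℝ)) k * poch ((n : ℝ) + α + β + 1) k /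
    (poch (2 * a + α + (N : ℝ) + 1) k * poch (β + 1) k * poch (1 - (N : ℝ)) k *
      (Nat.factorial k : ℝ))

theorem racahCoeff_succ {a α β : ℝ} {N n k : ℕ} (ha : -1 / 2 < a) (hα : -1 < α) (hβ : -1 < β)
    (hk : k + 1 < N) :
    (k + 1) * ((β + (k + 1)) * (2 * a + N + α + (k + 1)) * (N - (k + 1))) *
        racahCoeff a N n α β (k + 1) =
      (n * (n + α + β + 1) - k * (k + α + β + 1)) * racahCoeff a N n α β k := by
  have h0 : (0 : ℝ) ≤ k := k.cast_nonneg
  have h1 : (k : ℝ) + 1 + 1 ≤ N := by exact_mod_cast hk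
  have e1 : 2 * a + α + N + 1 + k ≠ 0 := by linarith
  have e2 : β + 1 + k ≠ 0 := by linarith
  have e3 : (1 : ℝ) - N + k ≠ 0 := by linarith
  have e4 : (k : ℝ) + 1 ≠ 0 := by linarith
  have hs : racahCoeff a N n α β (k + 1) = racahCoeff a N n α β k *
      (((-n + k) * (n + α + β + 1 + k)) /
        ((2 * a + α + N + 1 + k) * (β + 1 + k) * (1 - N + k) * (k + 1))) := by
    simp only [racahCoeff, poch, Finset.prod_range_succ, Nat.factorial_succ, Nat.cast_mul,
      Nat.cast_add, Nat.cast_one]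
    rw [div_mul_div_comm]
    congr 1 <;> ring
  rw [hs]
  field_simp
  ring

open Polynomial in
/-- The Racah polynomial as an element of `ℝ[X]`. -/
noncomputable def racahPolynomial (a : ℝ) (N n : ℕ) (α β : ℝ) : ℝ[X] :=
  ∑ k ∈ Finset.range (n + 1), C (racahCoeff a N n α β k) * racahBasis a k

open Polynomial in
theorem eval_racahPolynomial (a : ℝ) (N n : ℕ) (α β y : ℝ) :
    (racahPolynomial a N n α β).eval y =
      ∑ k ∈ Finset.range (n + 1), racahCoeff a N n α β k * (racahBasis a k).eval y := by
  simp [racahPolynomial, eval_finsetSum]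

open Polynomial in
theorem racahPoly_eq_eval (a : ℝ) (N n : ℕ) (α β y : ℝ) :
    racahPoly a N n α β y = (racahPolynomial a N n α β).eval y := by
  rw [eval_racahPolynomial, racahPoly]
  refine Finset.sum_congr rfl fun k _ => ?_
  rw [racahCoeff, div_mul_eq_mul_div]
  simp [racahBasis, eval_prod, racahNode]

theorem poch_ne_zero {c : ℝ} {k : ℕ} (h : ∀ j < k, c + j ≠ 0) : poch c k ≠ 0 :=
  Finset.prod_ne_zero_iff.2 fun j hj => h j (Finset.mem_range.1 hj)

theorem racahCoeff_self_ne_zero {a α β : ℝ} {N n : ℕ} (ha : -1 / 2 < a) (hα : -1 < α)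
    (hβ : -1 < β) (hn : 1 ≤ n) (hnN : n < N) : racahCoeff a N n α β n ≠ 0 := by
  have hn' : (1 : ℝ) ≤ n := by exact_mod_cast hn
  have hN' : (n : ℝ) + 1 ≤ N := by exact_mod_cast hnN
  refine div_ne_zero (mul_ne_zero ?_ ?_) (mul_ne_zero (mul_ne_zero (mul_ne_zero ?_ ?_) ?_)
    (Nat.cast_ne_zero.2 n.factorial_ne_zero)) <;> refine poch_ne_zero fun j hj => ?_ <;>
    have hj0 : (0 : ℝ) ≤ j := j.cast_nonneg <;>
    have hj1 : (j : ℝ) + 1 ≤ n := (by exact_mod_cast hj) <;> linarith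

open Polynomial in
theorem natDegree_racahPolynomial {a α β : ℝ} {N n : ℕ} (h : racahCoeff a N n α β n ≠ 0) :
    (racahPolynomial a N n α β).natDegree = n := by
  refine natDegree_eq_of_le_of_coeff_ne_zero ?_ ?_
  · refine natDegree_sum_le_of_forall_le _ _ fun k hk => ?_
    refine (natDegree_C_mul_le _ _).trans ?_
    rw [natDegree_racahBasis]
    exact Nat.lt_succ_iff.1 (Finset.mem_range.1 hk)
  · rw [racahPolynomial, finsetSum_coeff, Finset.sum_range_succ, Finset.sum_eq_zero, zero_add,
      coeff_C_mul]
    · exact mul_ne_zero h (coeff_racahBasis_self_ne_zero a n)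
    · intro k hk
      rw [coeff_C_mul, coeff_eq_zero_of_natDegree_lt, mul_zero]
      rw [natDegree_racahBasis]
      exact Finset.mem_range.1 hk

theorem racahDiffOp_racahPolynomial {a α β : ℝ} {N n : ℕ} (ha : -1 / 2 < a) (hα : -1 < α)
    (hβ : -1 < β) (hnN : n < N) (i : ℕ) :
    racahDiffOp a N α β (fun m => (racahPolynomial a N n α β).eval (racahNode a m)) i =
      -(n * (n + α + β + 1)) * (racahPolynomial a N n α β).eval (racahNode a i) := by
  have hlin : racahDiffOp a N α β
      (fun m => (racahPolynomial a N n α β).eval (racahNode a m)) i =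
      ∑ k ∈ Finset.range (n + 1), racahCoeff a N n α β k *
        racahDiffOp a N α β (fun m => (racahBasis a k).eval (racahNode a m)) i := by
    simp only [racahDiffOp, eval_racahPolynomial, ← Finset.sum_sub_distrib, Finset.mul_sum,
      ← Finset.sum_add_distrib]
    exact Finset.sum_congr rfl fun k _ => by ring
  have hsplit (k : ℕ) : racahCoeff a N n α β k *
      racahDiffOp a N α β (fun m => (racahBasis a k).eval (racahNode a m)) i =
      -(n * (n + α + β + 1)) * (racahCoeff a N n α β k * (racahBasis a k).eval (racahNode a i)) +
      ((n * (n + α + β + 1) - k * (k + α + β + 1)) * racahCoeff a N n α β k *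
          (racahBasis a k).eval (racahNode a i) -
        k * ((β + k) * (2 * a + N + α + k) * (N - k)) * racahCoeff a N n α β k *
          (racahBasis a (k - 1)).eval (racahNode a i)) := by
    rw [racahDiffOp_racahBasis ha]; ring
  rw [hlin, Finset.sum_congr rfl fun k _ => hsplit k, Finset.sum_add_distrib, ← Finset.mul_sum,
    ← eval_racahPolynomial, Finset.sum_sub_distrib, Finset.sum_range_succ, Finset.sum_range_succ']
  have hterm : ∀ k ∈ Finset.range n,
      (((k + 1 : ℕ) : ℝ) * ((β + (k + 1 : ℕ)) * (2 * a + N + α + (k + 1 : ℕ)) *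
        (N - (k + 1 : ℕ)))) * racahCoeff a N n α β (k + 1) *
        (racahBasis a (k + 1 - 1)).eval (racahNode a i) =
      (n * (n + α + β + 1) - k * (k + α + β + 1)) * racahCoeff a N n α β k *
          (racahBasis a k).eval (racahNode a i) := by
    intro k hk
    have := racahCoeff_succ (N := N) (n := n) (k := k) ha hα hβ
      (by have := Finset.mem_range.1 hk; omega)
    push_cast
    rw [this]
  rw [Finset.sum_congr rfl hterm]
  push_cast
  ring

theorem discreteOrthogonal_racahPolynomial {a α β : ℝ} {N n : ℕ} (ha : -1 / 2 < a) (hα : -1 < α)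
    (hβ : -1 < β) (hβ' : β < 2 * a + 1) (hnN : n < N) :
    DiscreteOrthogonal (racahNode a) (racahWeight a N α β) N n (racahPolynomial a N n α β) := by
  refine DiscreteOrthogonal.of_racahBasis a fun k => ?_
  induction k using Nat.strong_induction_on with
  | _ k ih =>
  intro hk
  have hcomm := sum_racahDiffOp_comm (N := N) ha hα hβ'
    (fun m => (racahPolynomial a N n α β).eval (racahNode a m))
    (fun m => (racahBasis a k).eval (racahNode a m))
  simp only [racahDiffOp_racahPolynomial ha hα hβ hnN, racahDiffOp_racahBasis ha] at hcomm
  set S := ∑ i ∈ Finset.range N, racahWeight a N α β i *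
    ((racahPolynomial a N n α β).eval (racahNode a i) * (racahBasis a k).eval (racahNode a i))
    with hS
  have hlow : k * ∑ i ∈ Finset.range N, racahWeight a N α β i *
      ((racahPolynomial a N n α β).eval (racahNode a i) *
        (racahBasis a (k - 1)).eval (racahNode a i)) = 0 := by
    rcases k with _ | k
    · simp
    · rw [Nat.add_sub_cancel, ih k (by omega) (by omega), mul_zero]
  set T := ∑ i ∈ Finset.range N, racahWeight a N α β i *
      ((racahPolynomial a N n α β).eval (racahNode a i) *
        (racahBasis a (k - 1)).eval (racahNode a i)) with hT
  have hl : ∑ i ∈ Finset.range N, racahWeight a N α β i *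
      (-(n * (n + α + β + 1)) * (racahPolynomial a N n α β).eval (racahNode a i) *
        (racahBasis a k).eval (racahNode a i)) = -(n * (n + α + β + 1)) * S := by
    rw [hS, Finset.mul_sum]
    exact Finset.sum_congr rfl fun i _ => by ring
  have hr : ∑ i ∈ Finset.range N, racahWeight a N α β i *
      ((racahPolynomial a N n α β).eval (racahNode a i) *
        (-(k * (k + α + β + 1) * (racahBasis a k).eval (racahNode a i)) -
        k * ((β + k) * (2 * a + N + α + k) * (N - k)) *
          (racahBasis a (k - 1)).eval (racahNode a i))) =
      -(k * (k + α + β + 1)) * S - ((β + k) * (2 * a + N + α + k) * (N - k)) * (k * T) := by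
    rw [hS, hT, Finset.mul_sum, Finset.mul_sum, Finset.mul_sum, ← Finset.sum_sub_distrib]
    exact Finset.sum_congr rfl fun i _ => by ring
  rw [hl, hr, hlow] at hcomm
  have hk' : (k : ℝ) + 1 ≤ n := by exact_mod_cast hk
  have hk0 : (0 : ℝ) ≤ k := k.cast_nonneg
  have hne : ((n : ℝ) - k) * (n + k + α + β + 1) ≠ 0 :=
    mul_ne_zero (by linarith) (by linarith)
  refine (mul_eq_zero.1 (?_ : ((n : ℝ) - k) * (n + k + α + β + 1) * S = 0)).resolve_left hne
  linear_combination -hcomm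

theorem DiscreteOrthogonal.of_C_mul {x w : ℕ → ℝ} {N n : ℕ} {p : Polynomial ℝ} {c : ℝ}
    (hc : c ≠ 0) (h : DiscreteOrthogonal x w N n (Polynomial.C c * p)) :
    DiscreteOrthogonal x w N n p := by
  intro q hq
  refine (mul_eq_zero.1 (?_ : c * _ = 0)).resolve_left hc
  rw [← h q hq, Finset.mul_sum]
  refine Finset.sum_congr rfl fun i _ => ?_
  rw [Polynomial.eval_mul, Polynomial.eval_C]
  ring

theorem exists_racahPoly_zeros {a α β : ℝ} {N n : ℕ} (ha : -1 / 2 < a) (hα : -1 < α)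
    (hβ : -1 < β) (hβ' : β < 2 * a + 1) (hn : 1 ≤ n) (hnN : n < N) :
    ∃ Z : Fin n → ℝ, StrictMono Z ∧
      (∀ j, Z j ∈ Set.Ioo (racahNode a 0) (racahNode a (N - 1))) ∧
      (∀ y, racahPoly a N n α β y = 0 ↔ ∃ j, y = Z j) ∧
      DiscreteOrthogonal (racahNode a) (racahWeight a N α β) N n
        (Lagrange.nodal Finset.univ Z) := by
  have hort := discreteOrthogonal_racahPolynomial ha hα hβ hβ' hnN
  have hdeg := natDegree_racahPolynomial (racahCoeff_self_ne_zero ha hα hβ hn hnN)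
  have hne : racahPolynomial a N n α β ≠ 0 := by
    intro h
    rw [h, Polynomial.natDegree_zero] at hdeg
    omega
  obtain ⟨Z, hmono, hIoo, hfac⟩ := hort.exists_strictMono_roots (racahNode_strictMono ha)
    (fun i hi => racahWeight_pos ha hα hβ hβ' hi) hnN hdeg hne
  have hlc := Polynomial.leadingCoeff_ne_zero.2 hne
  refine ⟨Z, hmono, hIoo, fun y => ?_, DiscreteOrthogonal.of_C_mul hlc (hfac ▸ hort)⟩
  rw [racahPoly_eq_eval, hfac, Polynomial.eval_mul, Polynomial.eval_C, Lagrange.eval_nodal,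
    mul_eq_zero, or_iff_right hlc, Finset.prod_eq_zero_iff]
  simp [sub_eq_zero]

/-- zeros of Racah polynomials: location and monotonicity in `α` and `β`. -/
theorem stmt_6 (a : ℝ) (ha : -1 / 2 < a) (N n : ℕ) (hN : 2 ≤ N) (hn : 1 ≤ n)
    (hnN : n ≤ N - 1) :
    ∃ X : ℝ → ℝ → Fin n → ℝ,
      (∀ α β : ℝ, -1 < α → -1 < β → β < 2 * a + 1 →
        StrictMono (X α β) ∧
        (∀ j, X α β j ∈ Set.Ioo (a * (a + 1)) ((a + (N : ℝ) - 1) * (a + (N : ℝ)))) ∧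
        (∀ j, racahPoly a N n α β (X α β j) = 0) ∧
        (∀ y : ℝ, racahPoly a N n α β y = 0 → ∃ j, y = X α β j)) ∧
      (0 ≤ a →
        (∀ β : ℝ, -1 < β → β < 2 * a + 1 →
          ∀ j, StrictAntiOn (fun α => X α β j) (Set.Ioi (-1))) ∧
        (∀ α : ℝ, -1 < α →
          ∀ j, StrictMonoOn (fun β => X α β j) (Set.Ioo (-1) (2 * a + 1)))) ∧
      (a < 0 →
        (∀ β : ℝ, a < β → β < 2 * a + 1 →
          ∀ j, StrictAntiOn (fun α => X α β j) (Set.Ioi (-1))) ∧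
        (∀ α : ℝ, -1 < α →
          ∀ j, StrictMonoOn (fun β => X α β j) (Set.Ioo a (2 * a + 1)))) := by
  have hlt : n < N := by omega
  have hex : ∀ α β : ℝ, ∃ Z : Fin n → ℝ, -1 < α → -1 < β → β < 2 * a + 1 → StrictMono Z ∧
      (∀ j, Z j ∈ Set.Ioo (racahNode a 0) (racahNode a (N - 1))) ∧
      (∀ y, racahPoly a N n α β y = 0 ↔ ∃ j, y = Z j) ∧
      DiscreteOrthogonal (racahNode a) (racahWeight a N α β) N n
        (Lagrange.nodal Finset.univ Z) := by
    intro α β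
    by_cases h : -1 < α ∧ -1 < β ∧ β < 2 * a + 1
    · obtain ⟨Z, hZ⟩ := exists_racahPoly_zeros ha h.1 h.2.1 h.2.2 hn hlt
      exact ⟨Z, fun _ _ _ => hZ⟩
    · exact ⟨0, fun h1 h2 h3 => absurd ⟨h1, h2, h3⟩ h⟩
  choose Z hZ using hex
  have hx := racahNode_strictMono ha
  have hα : ∀ β : ℝ, -1 < β → β < 2 * a + 1 →
      ∀ j, StrictAntiOn (fun α => Z α β j) (Set.Ioi (-1)) := by
    intro β hβ hβ' j α₁ h₁ α₂ h₂ h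
    rw [Set.mem_Ioi] at h₁ h₂
    obtain ⟨m₁, -, -, o₁⟩ := hZ α₁ β h₁ hβ hβ'
    obtain ⟨m₂, l₂, -, o₂⟩ := hZ α₂ β h₂ hβ hβ'
    exact DiscreteOrthogonal.root_lt_root hx hlt (fun i hi => racahWeight_pos ha h₂ hβ hβ' hi)
      (fun i hi => racahWeight_pos ha h₁ hβ hβ' hi)
      (racahWeight_div_lt ha (fun i hi => racahRatio_pos ha h₂ hβ hβ' hi)
        fun i hi => racahRatio_lt_of_alpha_lt ha h₁ h hβ hβ' hi)
      m₂ m₁ (fun j => (l₂ j).1.le) o₂ o₁ j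
  have hβ : ∀ α : ℝ, -1 < α →
      ∀ j, StrictMonoOn (fun β => Z α β j) (Set.Ioo (-1) (2 * a + 1)) := by
    intro α hα j β₁ h₁ β₂ h₂ h
    obtain ⟨m₁, l₁, -, o₁⟩ := hZ α β₁ hα h₁.1 h₁.2
    obtain ⟨m₂, -, -, o₂⟩ := hZ α β₂ hα h₂.1 h₂.2
    exact DiscreteOrthogonal.root_lt_root hx hlt
      (fun i hi => racahWeight_pos ha hα h₁.1 h₁.2 hi)
      (fun i hi => racahWeight_pos ha hα h₂.1 h₂.2 hi)
      (racahWeight_div_lt ha (fun i hi => racahRatio_pos ha hα h₁.1 h₁.2 hi)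
        fun i hi => racahRatio_lt_of_beta_lt ha hα h₁.1 h h₂.2 hi)
      m₁ m₂ (fun j => (l₁ j).1.le) o₁ o₂ j
  refine ⟨Z, fun α β h₁ h₂ h₃ => ?_, fun _ => ⟨hα, hβ⟩, fun _ =>
    ⟨fun β h₁ h₂ => hα β (by linarith) h₂, fun α h₁ j => (hβ α h₁ j).mono
      (Set.Ioo_subset_Ioo_left (by linarith))⟩⟩
  obtain ⟨hm, hI, hz, -⟩ := hZ α β h₁ h₂ h₃
  have hn0 : racahNode a 0 = a * (a + 1) := by simp [racahNode]
  have hn1 : racahNode a (N - 1) = (a + (N : ℝ) - 1) * (a + (N : ℝ)) := by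
    rw [racahNode, Nat.cast_sub (by omega)]
    push_cast
    ring
  rw [hn0, hn1] at hI
  exact ⟨hm, hI, fun j => (hz _).2 ⟨j, rfl⟩, fun y => (hz y).1⟩
end
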